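/- arXiv:2107.07294 — 2 statements merged into one kernel-verified Lean document; each statement's English description precedes it below -/
import Mathlib

section
/- Suppose preferences ≿ on ℝ^L_+ are continuous, strictly convex, monotone and Lipschitzian, and demand observations (p_k, f^≿(p_k)) are taken along a sequence of prices dense in ℝ^L_{++}. Then for any p ∈ ℝ^L_{++} and any ε > 0 there exists n such that the revealed demand correspondence satisfies x^{R_n}(p) ⊆ {x ∈ B(p) : ‖f^≿(p) − x‖ ≤ ε}. -/
namespace Paper

variable {L H : ℕ}

/-- Inner product of a price vector and a commodity bundle. -/
noncomputable def dot (p x : Fin L → ℝ) : ℝ := ∑ i, p i * x i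

/-- membership in the consumption set X = ℝ^L_+ -/
def nneg (x : Fin L → ℝ) : Prop := ∀ i, 0 ≤ x i

/-- strictly positive vector (interior of X, resp. p ≫ 0) -/
def posv (x : Fin L → ℝ) : Prop := ∀ i, 0 < x i

/-- a preference relation on bundles -/
abbrev Pref (L : ℕ) := (Fin L → ℝ) → (Fin L → ℝ) → Prop

/-- strict preference x ≻ y -/
def PStrict (R : Pref L) (x y : Fin L → ℝ) : Prop := R x y ∧ ¬ R y x

/-- complete and transitive preference relation on ℝ^L_+ -/
def IsPref (R : Pref L) : Prop :=
  (∀ x y, nneg x → nneg y → R x y ∨ R y x) ∧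
  (∀ x y z, R x y → R y z → R x z)

/-- monotone: u ≫ v implies u ≻ v -/
def MonoWeak (R : Pref L) : Prop :=
  ∀ u v : Fin L → ℝ, nneg v → (∀ i, v i < u i) → PStrict R u v

/-- monotone: u ≥ v, u ≠ v implies u ≻ v -/
def MonoStrong (R : Pref L) : Prop :=
  ∀ u v : Fin L → ℝ, nneg v → (∀ i, v i ≤ u i) → u ≠ v → PStrict R u v

/-- continuity: closed upper and lower contour sets -/
def ContPref (R : Pref L) : Prop :=
  ∀ x : Fin L → ℝ, IsClosed {y | R y x} ∧ IsClosed {y | R x y}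

/-- convexity: u ≿ v implies λu + (1-λ)v ≿ v -/
def PrefConvex (R : Pref L) : Prop :=
  ∀ u v : Fin L → ℝ, nneg u → nneg v → R u v →
    ∀ l : ℝ, 0 ≤ l → l ≤ 1 → R (l • u + (1 - l) • v) v

/-- strict convexity: u ≿ v, u ≠ v implies λu + (1-λ)v ≻ v for λ ∈ (0,1) -/
def PrefStrictConvex (R : Pref L) : Prop :=
  ∀ u v : Fin L → ℝ, nneg u → nneg v → R u v → u ≠ v →
    ∀ l : ℝ, 0 < l → l < 1 → PStrict R (l • u + (1 - l) • v) v

/-- the budget set B(p) = {x ∈ ℝ^L_+ : p·x ≤ 1} -/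
def Budget (p x : Fin L → ℝ) : Prop := nneg x ∧ dot p x ≤ 1

/-- x is a ≿-maximizer on the budget set B(p) (Walrasian demand) -/
def IsDemand (R : Pref L) (p x : Fin L → ℝ) : Prop :=
  Budget p x ∧ ∀ y, Budget p y → R x y

/-- membership in the box X_r = {w : (1+r)⁻¹ 𝟙 ≤ w ≤ (1+r) 𝟙} -/
def InBox (r : ℝ) (x : Fin L → ℝ) : Prop := ∀ i, (1 + r)⁻¹ ≤ x i ∧ x i ≤ 1 + r

/-- Lipschitzian preferences in the sense of Mas-Colell (1977) -/
def Lipschitzian (R : Pref L) : Prop :=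
  ∀ r : ℝ, 0 < r → ∃ K : ℝ, 0 < K ∧ ∃ ε : ℝ, 0 < ε ∧
    ∀ x y z : Fin L → ℝ, InBox r x → InBox r y → InBox r z →
      R x y → R y x → ‖x - z‖ < ε →
      Metric.infDist x {w | R w z} ≤ K * Metric.infDist y {w | R w z}

/-- x is strictly revealed preferred to y through the first n observations:
there is a chain x ≥ x_{i_1}, p_{i_j}·x_{i_{j+1}} < p_{i_j}·x_{i_j}, x_{i_N} ≥ y -/
def RevChain (p xo : ℕ → Fin L → ℝ) (n : ℕ) (x y : Fin L → ℝ) : Prop :=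
  ∃ N : ℕ, ∃ idx : Fin (N + 1) → ℕ,
    (∀ j, idx j < n) ∧
    (∀ i, xo (idx 0) i ≤ x i) ∧
    (∀ j : Fin N, dot (p (idx j.castSucc)) (xo (idx j.succ)) <
       dot (p (idx j.castSucc)) (xo (idx j.castSucc))) ∧
    (∀ i, y i ≤ xo (idx (Fin.last N)) i)

/-- the revealed demand correspondence x^{R_n}(q) -/
def RevDemand (p xo : ℕ → Fin L → ℝ) (n : ℕ) (q : Fin L → ℝ) : Set (Fin L → ℝ) :=
  {x | nneg x ∧ dot q x = 1 ∧
    ¬ ∃ x', nneg x' ∧ dot q x' ≤ 1 ∧ RevChain p xo n x' x}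

/-- the strong axiom of revealed preference for the first n observations -/
def SARP (p xo : ℕ → Fin L → ℝ) (n : ℕ) : Prop :=
  ∀ m : ℕ, 0 < m → ∀ idx : Fin (m + 1) → ℕ, (∀ j, idx j < n) →
    (∀ j j' : Fin (m + 1), j ≠ j' → xo (idx j) ≠ xo (idx j')) →
    (∀ j : Fin m, dot (p (idx j.castSucc)) (xo (idx j.succ)) ≤
       dot (p (idx j.castSucc)) (xo (idx j.castSucc))) →
    dot (p (idx (Fin.last m))) (xo (idx 0)) >
      dot (p (idx (Fin.last m))) (xo (idx (Fin.last m)))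

/-- the standard regularity package: complete, transitive, continuous,
monotone, strictly convex -/
def Regular (R : Pref L) : Prop :=
  IsPref R ∧ ContPref R ∧ MonoStrong R ∧ PrefStrictConvex R

/-- aggregate demand d(p, w¹,…,w^H) = Σ_h f^h(p/w^h), where f^h is the
individual demand function at income 1 -/
noncomputable def aggDem (f : Fin H → (Fin L → ℝ) → (Fin L → ℝ)) (p : Fin L → ℝ) (w : Fin H → ℝ) :
    Fin L → ℝ :=
  fun i => ∑ h, f h (fun j => p j / w h) i

/-- membership in the (relatively interior) simplex Δ^{L-1} -/
def InSimplex (p : Fin L → ℝ) : Prop := posv p ∧ ∑ i, p i = 1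

/-- p is a Walrasian equilibrium price for the endowment profile eprof -/
def EqPrice (f : Fin H → (Fin L → ℝ) → (Fin L → ℝ)) (eprof : Fin H → Fin L → ℝ)
    (p : Fin L → ℝ) : Prop :=
  InSimplex p ∧ ∀ i, ∑ h, (f h (fun j => p j / dot p (eprof h)) i - eprof h i) = 0

/-- the income box W = ×_h [w̲_h, w̄_h] -/
def InW (wlo whi : Fin H → ℝ) (w : Fin H → ℝ) : Prop := ∀ h, wlo h ≤ w h ∧ w h ≤ whi h

/-- the set C_n of allocation profiles consistent with the first n observations:
adding up to aggregate demand, on the budget hyperplanes, satisfying SARP -/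
def InC (p : ℕ → Fin L → ℝ) (w : ℕ → Fin H → ℝ) (D : ℕ → Fin L → ℝ) (n : ℕ)
    (xa : ℕ → Fin H → Fin L → ℝ) : Prop :=
  (∀ k < n, ∀ h, nneg (xa k h)) ∧
  (∀ k < n, ∀ i, ∑ h, xa k h i = D k i) ∧
  (∀ k < n, ∀ h, dot (p k) (xa k h) = w k h) ∧
  (∀ h, SARP p (fun k => xa k h) n)

/-- x is equilibrium-revealed preferred to y by individual h given n observations -/
def EqRevPref (p : ℕ → Fin L → ℝ) (w : ℕ → Fin H → ℝ) (D : ℕ → Fin L → ℝ)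
    (n : ℕ) (h : Fin H) (x y : Fin L → ℝ) : Prop :=
  ∀ xa : ℕ → Fin H → Fin L → ℝ, InC p w D n xa → RevChain p (fun k => xa k h) n x y

/-- the equilibrium revealed demand correspondence x^{R^h_n}(q) -/
def EqRevDemand (p : ℕ → Fin L → ℝ) (w : ℕ → Fin H → ℝ) (D : ℕ → Fin L → ℝ)
    (n : ℕ) (h : Fin H) (q : Fin L → ℝ) : Set (Fin L → ℝ) :=
  {x | nneg x ∧ dot q x = 1 ∧
    ¬ ∃ x', nneg x' ∧ dot q x' ≤ 1 ∧ EqRevPref p w D n h x' x}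

/-- Assumption 1: any preference profile distinct from R generates a different
aggregate demand at some price and income profile in ℝ^L_{++} × W -/
def Assumption1 (R : Fin H → Pref L) (f : Fin H → (Fin L → ℝ) → (Fin L → ℝ))
    (wlo whi : Fin H → ℝ) : Prop :=
  ∀ (R' : Fin H → Pref L) (f' : Fin H → (Fin L → ℝ) → (Fin L → ℝ)),
    (∀ h, Regular (R' h) ∧ Lipschitzian (R' h)) →
    (∀ h q, posv q → IsDemand (R' h) q (f' h q)) →
    R' ≠ R →
    ∃ (pp : Fin L → ℝ) (ww : Fin H → ℝ), posv pp ∧ InW wlo whi ww ∧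
      aggDem f' pp ww ≠ aggDem f pp ww

/-- the revealed approximate equilibrium correspondence P^{R_n}(e^H) -/
def RevApproxEq (p : ℕ → Fin L → ℝ) (w : ℕ → Fin H → ℝ) (D : ℕ → Fin L → ℝ)
    (n : ℕ) (eprof : Fin H → Fin L → ℝ) : Set (Fin L → ℝ) :=
  {q | InSimplex q ∧
    ∃ xa : Fin H → Fin L → ℝ,
      (∀ h, nneg (xa h)) ∧
      (∀ h, dot q (xa h) = dot q (eprof h)) ∧
      (∀ i, ∑ h, (xa h i - eprof h i) = 0) ∧
      ¬ ∃ ya : Fin H → Fin L → ℝ,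
        (∀ h, nneg (ya h)) ∧ (∀ h, dot q (ya h) = dot q (eprof h)) ∧
        (∀ h, EqRevPref p w D n h (ya h) (xa h))}

lemma dot_add' (p x y : Fin L → ℝ) : dot p (x + y) = dot p x + dot p y := by
  simp [dot, mul_add, Finset.sum_add_distrib]

lemma dot_smul' (p x : Fin L → ℝ) (c : ℝ) : dot p (c • x) = c * dot p x := by
  simp only [dot, Pi.smul_apply, smul_eq_mul, Finset.mul_sum]
  exact Finset.sum_congr rfl (fun i _ => by ring)

lemma dot_zero' (p : Fin L → ℝ) : dot p 0 = 0 := by simp [dot]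

lemma dot_cont (p : Fin L → ℝ) : Continuous (fun x => dot p x) := by
  unfold dot; fun_prop

lemma dot_cont2 : Continuous (fun z : (Fin L → ℝ) × (Fin L → ℝ) => dot z.1 z.2) := by
  unfold dot; fun_prop

lemma dot_mono {p x y : Fin L → ℝ} (hp : posv p) (h : ∀ i, x i ≤ y i) : dot p x ≤ dot p y :=
  Finset.sum_le_sum (fun i _ => mul_le_mul_of_nonneg_left (h i) (hp i).le)

lemma dot_nonneg' {p x : Fin L → ℝ} (hp : posv p) (h : nneg x) : 0 ≤ dot p x :=
  Finset.sum_nonneg (fun i _ => mul_nonneg (hp i).le (h i))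

lemma dot_pos' (hL : 0 < L) {p x : Fin L → ℝ} (hp : posv p) (h : posv x) : 0 < dot p x :=
  Finset.sum_pos (fun i _ => mul_pos (hp i) (h i)) ⟨⟨0, hL⟩, Finset.mem_univ _⟩

lemma posv.nn {x : Fin L → ℝ} (h : posv x) : nneg x := fun i => (h i).le

lemma R_refl {R : Pref L} (hP : IsPref R) {x : Fin L → ℝ} (hx : nneg x) : R x x := by
  rcases hP.1 x x hx hx with h | h <;> exact h

lemma R_of_ge {R : Pref L} (hP : IsPref R) (hM : MonoStrong R) {x y : Fin L → ℝ} (hy : nneg y)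
    (h : ∀ i, y i ≤ x i) : R x y := by
  by_cases e : x = y
  · rw [e]; exact R_refl hP hy
  · exact (hM x y hy h e).1

lemma isOpen_posv : IsOpen {x : Fin L → ℝ | posv x} := by
  have : {x : Fin L → ℝ | posv x} = ⋂ i, {x | 0 < x i} := by ext; simp [posv]
  rw [this]
  exact isOpen_iInter_of_finite (fun i => isOpen_lt continuous_const (continuous_apply i))

lemma isOpen_gt (y : Fin L → ℝ) : IsOpen {x : Fin L → ℝ | ∀ i, y i < x i} := by
  have : {x : Fin L → ℝ | ∀ i, y i < x i} = ⋂ i, {x | y i < x i} := by ext; simp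
  rw [this]
  exact isOpen_iInter_of_finite (fun i => isOpen_lt continuous_const (continuous_apply i))

lemma isOpen_lt' (y : Fin L → ℝ) : IsOpen {x : Fin L → ℝ | ∀ i, x i < y i} := by
  have : {x : Fin L → ℝ | ∀ i, x i < y i} = ⋂ i, {x | x i < y i} := by ext; simp
  rw [this]
  exact isOpen_iInter_of_finite (fun i => isOpen_lt (continuous_apply i) continuous_const)

lemma isClosed_nneg : IsClosed {x : Fin L → ℝ | nneg x} := by
  have : {x : Fin L → ℝ | nneg x} = ⋂ i, {x | 0 ≤ x i} := by ext; simp [nneg]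
  rw [this]
  exact isClosed_iInter (fun i => isClosed_le continuous_const (continuous_apply i))

/-- Anything weakly preferred to a demanded bundle costs at least 1. -/
lemma demand_support (hL : 0 < L) {R : Pref L} (hP : IsPref R) (hM : MonoStrong R)
    {p x y : Fin L → ℝ} (hp : posv p) (hx : IsDemand R p x) (hy : nneg y) (h : R y x) :
    1 ≤ dot p y := by
  by_contra hlt
  push Not at hlt
  have he : 0 < dot p (1 : Fin L → ℝ) := dot_pos' hL hp (fun i => by simp)
  set s := (1 - dot p y) / dot p (1 : Fin L → ℝ) with hs
  have hs0 : 0 < s := div_pos (by linarith) he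
  have hb : dot p (y + s • (1 : Fin L → ℝ)) ≤ 1 := by
    rw [dot_add', dot_smul', hs, div_mul_cancel₀ _ he.ne']; linarith
  have hst := hM (y + s • (1 : Fin L → ℝ)) y hy (fun i => by simp [hs0.le]) (by
    intro e
    have := congrFun e ⟨0, hL⟩
    simp at this; linarith)
  have hn : nneg (y + s • (1 : Fin L → ℝ)) := fun i => by
    have := hy i; simp; linarith
  exact hst.2 (hP.2 _ _ _ h (hx.2 _ ⟨hn, hb⟩))

lemma demand_walras (hL : 0 < L) {R : Pref L} (hP : IsPref R) (hM : MonoStrong R)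
    {p x : Fin L → ℝ} (hp : posv p) (hx : IsDemand R p x) : dot p x = 1 :=
  le_antisymm hx.1.2 (demand_support hL hP hM hp hx hx.1.1 (R_refl hP hx.1.1))

lemma upper_convex {R : Pref L} (hP : IsPref R) (hSC : PrefStrictConvex R)
    (x : Fin L → ℝ) : Convex ℝ {y | nneg y ∧ R y x} := by
  have key : ∀ u v : Fin L → ℝ, nneg u → nneg v → R u v → R v x → ∀ a b : ℝ, 0 ≤ a → 0 ≤ b →
      a + b = 1 → R (a • u + b • v) x := by
    intro u v hu hv huv hvx a b ha hb hab
    by_cases e : u = v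
    · subst e; rw [← add_smul, hab, one_smul]; exact hvx
    rcases ha.eq_or_lt with h | h
    · subst h
      have : b = 1 := by linarith
      subst this; simpa using hvx
    rcases hb.eq_or_lt with h' | h'
    · subst h'
      have : a = 1 := by linarith
      subst this; simpa using hP.2 _ _ _ huv hvx
    have : b = 1 - a := by linarith
    subst this
    exact hP.2 _ _ _ (hSC u v hu hv huv e a h (by linarith)).1 hvx
  intro u hu v hv a b ha hb hab
  refine ⟨fun i => ?_, ?_⟩
  · have := mul_nonneg ha (hu.1 i)
    have := mul_nonneg hb (hv.1 i)
    simp; linarith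
  · rcases hP.1 u v hu.1 hv.1 with h | h
    · exact key u v hu.1 hv.1 h hv.2 a b ha hb hab
    · rw [add_comm]
      exact key v u hv.1 hu.1 h hu.2 b a hb ha (by linarith)

/-- Supporting price at an interior bundle. -/
lemma exists_support (hL : 0 < L) {R : Pref L} (hP : IsPref R) (hC : ContPref R)
    (hM : MonoStrong R) (hSC : PrefStrictConvex R) {x : Fin L → ℝ} (hx : posv x) :
    ∃ p, posv p ∧ dot p x = 1 ∧ ∀ y, nneg y → R y x → 1 ≤ dot p y := by
  have hopen : IsOpen {y : Fin L → ℝ | ∀ i, y i < x i} := isOpen_lt' x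
  have hconv : Convex ℝ {y : Fin L → ℝ | ∀ i, y i < x i} := by
    have : {y : Fin L → ℝ | ∀ i, y i < x i} = Set.pi Set.univ (fun i => Set.Iio (x i)) := by
      ext; simp
    rw [this]
    exact convex_pi (fun i _ => convex_Iio _)
  have hdisj : Disjoint {y : Fin L → ℝ | ∀ i, y i < x i} {y | nneg y ∧ R y x} := by
    rw [Set.disjoint_left]
    rintro y hy ⟨hn, hr⟩
    refine (hM x y hn (fun i => (hy i).le) ?_).2 hr
    intro e; have := hy ⟨0, hL⟩; rw [e] at this; exact lt_irrefl _ this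
  obtain ⟨f, u, hf1, hf2⟩ := geometric_hahn_banach_open hconv hopen (upper_convex hP hSC x) hdisj
  set c : Fin L → ℝ := fun i => f (Pi.single i 1) with hc
  have hfd : ∀ y, f y = dot c y := by
    intro y
    conv_lhs => rw [← Finset.univ_sum_single y]
    rw [map_sum]
    refine Finset.sum_congr rfl (fun i _ => ?_)
    have : (Pi.single i (y i) : Fin L → ℝ) = y i • Pi.single i (1 : ℝ) := by
      rw [← Pi.single_smul]; simp
    rw [this, map_smul, smul_eq_mul, hc, mul_comm]
  have hxu : u ≤ dot c x := by rw [← hfd]; exact hf2 x ⟨hx.nn, R_refl hP hx.nn⟩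
  have hxl : dot c x ≤ u := by
    have ht : Filter.Tendsto (fun s : ℝ => dot c (x + s • (-1 : Fin L → ℝ)))
        (nhdsWithin 0 (Set.Ioi 0)) (nhds (dot c x)) := by
      have : Continuous (fun s : ℝ => dot c (x + s • (-1 : Fin L → ℝ))) :=
        (dot_cont c).comp (by fun_prop)
      have h := this.tendsto 0
      simp only [zero_smul, add_zero] at h
      exact h.mono_left nhdsWithin_le_nhds
    refine le_of_tendsto ht ?_
    filter_upwards [self_mem_nhdsWithin] with s hs
    rw [← hfd]
    refine (hf1 _ ?_).le
    intro i
    simp only [Set.mem_Ioi] at hs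
    simp [hs]
  have hux : u = dot c x := le_antisymm hxu hxl
  have hup : ∀ y, nneg y → R y x → dot c x ≤ dot c y := by
    intro y hy hr; rw [← hux, ← hfd]; exact hf2 y ⟨hy, hr⟩
  have hc0 : ∀ i, 0 ≤ c i := by
    intro i
    have hn : nneg (x + Pi.single i (1 : ℝ)) := fun j => by
      have := (hx j).le
      have h2 : (0 : ℝ) ≤ (Pi.single i (1 : ℝ) : Fin L → ℝ) j := by
        by_cases e : j = i
        · subst e; simp
        · simp [e]
      simp only [Pi.add_apply]; linarith
    have := hup (x + Pi.single i (1 : ℝ)) hn (R_of_ge hP hM hx.nn (fun j => by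
        have h2 : (0 : ℝ) ≤ (Pi.single i (1 : ℝ) : Fin L → ℝ) j := by
          by_cases e : j = i
          · subst e; simp
          · simp [e]
        simp only [Pi.add_apply]; linarith))
    rw [dot_add', ← hfd (Pi.single i 1)] at this
    change 0 ≤ f (Pi.single i 1)
    linarith
  -- value is positive
  have hlt : dot c (0 : Fin L → ℝ) < u := by rw [← hfd]; exact hf1 0 (fun i => hx i)
  rw [dot_zero', hux] at hlt
  obtain ⟨j, hj⟩ : ∃ j, 0 < c j := by
    by_contra hcon
    push Not at hcon
    have : c = 0 := funext (fun i => le_antisymm (hcon i) (hc0 i))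
    rw [this] at hlt; simp [dot] at hlt
  have hcpos : posv c := by
    intro i
    rcases (hc0 i).eq_or_lt with h | h
    swap
    · exact h
    exfalso
    have hij : i ≠ j := by rintro rfl; linarith
    set w : Fin L → ℝ := x + Pi.single i (1 : ℝ) with hw
    have hst : ¬ R x w := (hM w x hx.nn (fun j => by
        have h2 : (0 : ℝ) ≤ (Pi.single i (1 : ℝ) : Fin L → ℝ) j := by
          by_cases e : j = i
          · subst e; simp
          · simp [e]
        simp only [hw, Pi.add_apply]; linarith) (by
        intro e; have := congrFun e i; simp [hw] at this)).2
    have hO : IsOpen ({y | R x y}ᶜ ∩ {y | posv y}) := (hC x).2.isOpen_compl.inter isOpen_posv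
    have hcont : Continuous (fun s : ℝ => w - s • (Pi.single j (1 : ℝ) : Fin L → ℝ)) := by fun_prop
    have hmem : (w - (0:ℝ) • (Pi.single j (1 : ℝ) : Fin L → ℝ)) ∈ ({y | R x y}ᶜ ∩ {y | posv y}) := by
      simp only [zero_smul, sub_zero]
      refine ⟨hst, fun k => ?_⟩
      have := hx k
      have h2 : (0 : ℝ) ≤ (Pi.single i (1 : ℝ) : Fin L → ℝ) k := by
        by_cases e : k = i
        · subst e; simp
        · simp [e]
      simp only [hw, Pi.add_apply]; linarith
    have hev := hcont.continuousAt.preimage_mem_nhds (hO.mem_nhds hmem)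
    have hev2 : ∀ᶠ s in nhdsWithin (0:ℝ) (Set.Ioi 0),
        (w - s • (Pi.single j (1 : ℝ) : Fin L → ℝ)) ∈ ({y | R x y}ᶜ ∩ {y | posv y}) :=
      nhdsWithin_le_nhds hev
    obtain ⟨s, hs, hs0⟩ := (hev2.and self_mem_nhdsWithin).exists
    replace hs0 : 0 < s := hs0
    have hr : R (w - s • (Pi.single j (1 : ℝ) : Fin L → ℝ)) x :=
      (hP.1 _ _ hs.2.nn hx.nn).resolve_right hs.1
    have := hup _ hs.2.nn hr
    rw [← hfd (w - _), map_sub, map_smul, hw, map_add, hfd x] at this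
    change dot c x ≤ dot c x + c i - s • c j at this
    rw [← h, smul_eq_mul] at this
    nlinarith
  refine ⟨(dot c x)⁻¹ • c, fun i => ?_, ?_, ?_⟩
  · exact mul_pos (inv_pos.2 hlt) (hcpos i)
  · have : dot ((dot c x)⁻¹ • c) x = (dot c x)⁻¹ * dot c x := by
      simp only [dot, Pi.smul_apply, smul_eq_mul, Finset.mul_sum]
      exact Finset.sum_congr rfl (fun i _ => by ring)
    rw [this, inv_mul_cancel₀ hlt.ne']
  · intro y hy hr
    have : dot ((dot c x)⁻¹ • c) y = (dot c x)⁻¹ * dot c y := by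
      simp only [dot, Pi.smul_apply, smul_eq_mul, Finset.mul_sum]
      exact Finset.sum_congr rfl (fun i _ => by ring)
    rw [this, ← inv_mul_cancel₀ hlt.ne']
    exact mul_le_mul_of_nonneg_left (hup y hy hr) (inv_pos.2 hlt).le

/-- Observed demands are dense in the interior of the orthant. -/
lemma obs_dense (hL : 0 < L) {R : Pref L} (hP : IsPref R) (hC : ContPref R)
    (hM : MonoStrong R) (hSC : PrefStrictConvex R)
    {p xo : ℕ → Fin L → ℝ} (hp : ∀ k, posv (p k))
    (hdense : ∀ q : Fin L → ℝ, posv q → ∀ ε : ℝ, 0 < ε → ∃ k, ‖p k - q‖ < ε)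
    (hdem : ∀ k, IsDemand R (p k) (xo k))
    {x : Fin L → ℝ} (hx : posv x) {O : Set (Fin L → ℝ)} (hO : IsOpen O) (hxO : x ∈ O) :
    ∃ k, xo k ∈ O := by
  obtain ⟨p0, hp0, hp0x, hsup⟩ := exists_support hL hP hC hM hSC hx
  choose k hk using fun n : ℕ => hdense p0 hp0 (1 / ((n : ℝ) + 1)) (by positivity)
  have hpt : Filter.Tendsto (fun n => p (k n)) Filter.atTop (nhds p0) := by
    rw [tendsto_iff_norm_sub_tendsto_zero]
    exact squeeze_zero (fun n => norm_nonneg _) (fun n => (hk n).le)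
      tendsto_one_div_add_atTop_nhds_zero_nat
  have hev : ∀ᶠ n in Filter.atTop, xo (k n) ∈
      Set.pi Set.univ (fun i => Set.Icc (0 : ℝ) (2 / p0 i)) := by
    have hlow : ∀ᶠ n in Filter.atTop, p (k n) ∈ {z : Fin L → ℝ | ∀ i, ((1/2 : ℝ) • p0) i < z i} :=
      hpt.eventually ((isOpen_gt _).mem_nhds (fun i => by
        have := hp0 i
        simp only [Pi.smul_apply, smul_eq_mul]; linarith))
    filter_upwards [hlow] with n hn i _
    have h0 := (hdem (k n)).1.1
    refine ⟨h0 i, ?_⟩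
    have h1 : p (k n) i * xo (k n) i ≤ dot (p (k n)) (xo (k n)) :=
      Finset.single_le_sum (f := fun i => p (k n) i * xo (k n) i)
        (fun j _ => mul_nonneg (hp _ j).le (h0 j)) (Finset.mem_univ i)
    have h2 := (hdem (k n)).1.2
    have h3 := hn i
    simp only [Pi.smul_apply, smul_eq_mul] at h3
    rw [le_div_iff₀ (hp0 i)]
    nlinarith [h0 i]
  obtain ⟨xh, _, φ, hφ, hlim⟩ := (isCompact_univ_pi
    (fun i => isCompact_Icc (a := (0:ℝ)) (b := 2 / p0 i))).tendsto_subseq' hev.frequently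
  have hpt' : Filter.Tendsto (fun n => p (k (φ n))) Filter.atTop (nhds p0) :=
    hpt.comp hφ.tendsto_atTop
  have hlim' : Filter.Tendsto (fun n => xo (k (φ n))) Filter.atTop (nhds xh) := hlim
  have hxh : nneg xh := isClosed_nneg.mem_of_tendsto hlim'
    (Filter.Eventually.of_forall (fun n => (hdem _).1.1))
  have hcost : dot p0 xh = 1 := by
    have h1 : Filter.Tendsto (fun n => dot (p (k (φ n))) (xo (k (φ n)))) Filter.atTop
        (nhds (dot p0 xh)) := (dot_cont2.tendsto (p0, xh)).comp (hpt'.prodMk_nhds hlim')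
    simp only [fun j => demand_walras hL hP hM (hp j) (hdem j)] at h1
    exact tendsto_nhds_unique h1 tendsto_const_nhds |>.symm ▸ rfl
  have hR1 : ∀ s : ℝ, 0 < s → s < 1 → R xh ((1 - s) • x) := by
    intro s hs hs1
    have h1 : Filter.Tendsto (fun n => dot (p (k (φ n))) ((1 - s) • x)) Filter.atTop
        (nhds (dot p0 ((1 - s) • x))) :=
      (dot_cont2.tendsto (p0, (1 - s) • x)).comp (hpt'.prodMk_nhds tendsto_const_nhds)
    have h2 : dot p0 ((1 - s) • x) < 1 := by rw [dot_smul', hp0x]; linarith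
    refine (hC ((1 - s) • x)).1.mem_of_tendsto hlim' ?_
    filter_upwards [h1.eventually (gt_mem_nhds h2)] with n hn
    exact (hdem _).2 _ ⟨fun i => mul_nonneg (by linarith) (hx i).le, hn.le⟩
  have shrink : ∀ w : Fin L → ℝ, Filter.Tendsto (fun s : ℝ => (1 - s) • w)
      (nhdsWithin 0 (Set.Ioi 0)) (nhds w) := by
    intro w
    have h : Continuous (fun s : ℝ => (1 - s) • w) := by fun_prop
    have := h.tendsto 0
    simp only [sub_zero, one_smul] at this
    exact this.mono_left nhdsWithin_le_nhds
  have hlt1 : ∀ᶠ s : ℝ in nhdsWithin 0 (Set.Ioi 0), s < 1 :=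
    nhdsWithin_le_nhds (gt_mem_nhds one_pos)
  have hpos1 : ∀ᶠ s : ℝ in nhdsWithin 0 (Set.Ioi 0), 0 < s := self_mem_nhdsWithin
  have hR : R xh x := by
    refine (hC xh).2.mem_of_tendsto (shrink x) ?_
    filter_upwards [hlt1, hpos1] with s h1 h2
    exact hR1 s h2 h1
  have hEq : xh = x := by
    by_contra hne
    have hm := hSC xh x hxh hx.nn hR hne (1/2) (by norm_num) (by norm_num)
    set w : Fin L → ℝ := (1/2 : ℝ) • xh + (1 - 1/2 : ℝ) • x with hw
    have hwn : nneg w := fun i => by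
      have := hxh i
      have := (hx i).le
      simp only [hw, Pi.add_apply, Pi.smul_apply, smul_eq_mul]; linarith
    have hwc : dot p0 w = 1 := by
      rw [hw, dot_add', dot_smul', dot_smul', hcost, hp0x]; norm_num
    have h1 : ∀ᶠ s : ℝ in nhdsWithin 0 (Set.Ioi 0), ¬ R x ((1 - s) • w) :=
      (shrink w).eventually ((hC x).2.isOpen_compl.mem_nhds hm.2)
    obtain ⟨s, ⟨hs, hs1⟩, hs0⟩ := ((h1.and hlt1).and hpos1).exists
    have hn : nneg ((1 - s) • w) := fun i => mul_nonneg (by linarith) (hwn i)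
    have := hsup _ hn ((hP.1 _ _ hn hx.nn).resolve_right hs)
    rw [dot_smul', hwc] at this
    linarith
  rw [hEq] at hlim'
  obtain ⟨n, hn⟩ := (hlim'.eventually (hO.mem_nhds hxO)).exists
  exact ⟨_, hn⟩

/-- On the ray through `x` every lower level is attained. -/
lemma ray_level {R : Pref L} (hP : IsPref R) (hC : ContPref R) (hM : MonoStrong R)
    {x w : Fin L → ℝ} (hx : nneg x) (hw : nneg w) (h : R x w) :
    ∃ μ : ℝ, 0 ≤ μ ∧ μ ≤ 1 ∧ R (μ • x) w ∧ R w (μ • x) := by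
  have hcont : Continuous (fun s : ℝ => s • x) := by fun_prop
  have := isPreconnected_closed_iff.1 (isPreconnected_Icc (a := (0:ℝ)) (b := 1))
    ((fun s : ℝ => s • x) ⁻¹' {y | R y w}) ((fun s : ℝ => s • x) ⁻¹' {y | R w y})
    ((hC w).1.preimage hcont) ((hC w).2.preimage hcont)
    (fun s hs => hP.1 _ _ (fun i => mul_nonneg hs.1 (hx i)) hw)
    ⟨1, by simp, by simpa using h⟩
    ⟨0, by simp, by
      simp only [Set.mem_preimage, zero_smul, Set.mem_ofPred_eq]
      exact R_of_ge hP hM (fun i => le_refl _) hw⟩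
  obtain ⟨μ, hμ, h1, h2⟩ := this
  exact ⟨μ, hμ.1, hμ.2, h1, h2⟩

/-- One step of the level-loss estimate. -/
lemma level_step (hL : 0 < L) {R : Pref L} (hP : IsPref R) (hC : ContPref R) (hM : MonoStrong R)
    {K e r : ℝ} (hK : 0 < K)
    (hLip : ∀ x y z : Fin L → ℝ, InBox r x → InBox r y → InBox r z →
      R x y → R y x → ‖x - z‖ < e →
      Metric.infDist x {w | R w z} ≤ K * Metric.infDist y {w | R w z})
    {b : Fin L → ℝ} (hb : posv b) {bm : ℝ} (hbm : 0 < bm) (hbb : ∀ i, bm ≤ b i)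
    {x x' p : Fin L → ℝ} (hx : posv x) (hx' : nneg x') {X m κ D : ℝ}
    (hX : ‖x‖ ≤ X) (hD : 0 < D) (hD1 : D ≤ 1) (hκ : 0 < κ) (hκX : K * X < κ * bm)
    (hm : 1 ≤ m - κ * D) (hκD : κ * D ≤ 1) (hκe : κ * D * ‖b‖ < e)
    (hbox1 : ∀ μ : ℝ, 1 / 2 ≤ μ → μ ≤ 1 → InBox r (μ • x))
    (hbox2 : ∀ μ : ℝ, 1 ≤ μ → μ ≤ m → InBox r (μ • b))
    (hR : R x (m • b)) (hpx : dot p x ≤ 1 + D)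
    (hsup : ∀ y, nneg y → R y x' → 1 ≤ dot p y) : R x' ((m - κ * D) • b) := by
  by_contra hcon
  have hκD0 : 0 < κ * D := mul_pos hκ hD
  set z' : Fin L → ℝ := (m - κ * D) • b with hz'
  set z : Fin L → ℝ := m • b with hz
  have hz'n : nneg z' := fun i => mul_nonneg (by linarith) (hb i).le
  have hzn : nneg z := fun i => mul_nonneg (by linarith) (hb i).le
  have hz'x' : R z' x' := (hP.1 _ _ hx' hz'n).resolve_left hcon
  have hzz' : R z z' := R_of_ge hP hM hz'n (fun i => by
    simp only [hz, hz', Pi.smul_apply, smul_eq_mul]; nlinarith [hb i])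
  obtain ⟨μ, hμ0, hμ1, hy1, hy2⟩ := ray_level hP hC hM hx.nn hz'n (hP.2 _ _ _ hR hzz')
  have hyn : nneg (μ • x) := fun i => mul_nonneg hμ0 (hx i).le
  have h1 := hsup (μ • x) hyn (hP.2 _ _ _ hy1 hz'x')
  rw [dot_smul'] at h1
  have hμD : 1 ≤ μ * (1 + D) := h1.trans (mul_le_mul_of_nonneg_left hpx hμ0)
  have hμD' : 1 - μ ≤ D := by nlinarith
  have hμ2 : 1 / 2 ≤ μ := by nlinarith
  have hl := hLip z' (μ • x) z (hbox2 _ hm (by linarith)) (hbox1 μ hμ2 hμ1)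
    (hbox2 m (by linarith) le_rfl) hy2 hy1 (by
      have : z' - z = (-(κ * D)) • b := by rw [hz, hz', ← sub_smul]; congr 1; ring
      rw [this, norm_smul, Real.norm_eq_abs, abs_neg, abs_of_pos hκD0]
      exact hκe)
  have h2 : Metric.infDist (μ • x) {w | R w z} ≤ D * X := by
    refine (Metric.infDist_le_dist_of_mem (show x ∈ {w | R w z} from hR)).trans ?_
    have : μ • x - x = (-(1 - μ)) • x := by
      rw [show (-(1 - μ)) = μ - 1 by ring, sub_smul, one_smul]
    rw [dist_eq_norm, this, norm_smul, Real.norm_eq_abs, abs_neg, abs_of_nonneg (by linarith)]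
    exact mul_le_mul hμD' hX (norm_nonneg _) hD.le
  have h3 : κ * D * bm ≤ Metric.infDist z' {w | R w z} := by
    refine (Metric.le_infDist ⟨x, hR⟩).2 ?_
    intro w hw
    by_contra hlt
    push Not at hlt
    rw [dist_eq_norm] at hlt
    have hc : ∀ i, |z' i - w i| < κ * D * bm := fun i => by
      have := norm_le_pi_norm (z' - w) i
      rw [Real.norm_eq_abs] at this
      exact this.trans_lt hlt
    have hwn : nneg w := fun i => by
      have h4 := (abs_lt.1 (hc i)).2
      have h5 : z' i = (m - κ * D) * b i := rfl
      have h6 : κ * D * bm ≤ 1 * b i := mul_le_mul hκD (hbb i) hbm.le (by norm_num)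
      have h7 : 1 * b i ≤ (m - κ * D) * b i := mul_le_mul_of_nonneg_right hm (hb i).le
      linarith
    have hwz : ∀ i, w i < z i := fun i => by
      have h4 := (abs_lt.1 (hc i)).1
      have h5 : z' i = (m - κ * D) * b i := rfl
      have h6 : κ * D * bm ≤ κ * D * b i := mul_le_mul_of_nonneg_left (hbb i) hκD0.le
      have h7 : z i = m * b i := rfl
      nlinarith
    refine (hM z w hwn (fun i => (hwz i).le) ?_).2 hw
    intro e'
    have := hwz ⟨0, hL⟩
    rw [e'] at this
    exact lt_irrefl _ this
  have h4 : κ * D * bm ≤ K * (D * X) := h3.trans (hl.trans (mul_le_mul_of_nonneg_left h2 hK.le))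
  nlinarith

/-- direct strict revealed preference between observations -/
def ObsStep (p xo : ℕ → Fin L → ℝ) (k l : ℕ) : Prop :=
  dot (p k) (xo l) < dot (p k) (xo k)

/-- bundles strictly revealed worse than the observation `k0` -/
def Reach (p xo : ℕ → Fin L → ℝ) (k0 : ℕ) : Set (Fin L → ℝ) :=
  {w | ∃ k, Relation.ReflTransGen (ObsStep p xo) k0 k ∧ dot (p k) w < 1}

lemma isOpen_reach (p xo : ℕ → Fin L → ℝ) (k0 : ℕ) : IsOpen (Reach p xo k0) := by
  have : Reach p xo k0 = ⋃ k, ⋃ _ : Relation.ReflTransGen (ObsStep p xo) k0 k,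
      {w | dot (p k) w < 1} := by
    ext w; simp [Reach]
  rw [this]
  exact isOpen_iUnion (fun k => isOpen_iUnion
    (fun _ => isOpen_lt (dot_cont _) continuous_const))

lemma reach_down {p xo : ℕ → Fin L → ℝ} (hp : ∀ k, posv (p k)) {k0 : ℕ} {x y : Fin L → ℝ}
    (h : ∀ i, y i ≤ x i) (hx : x ∈ Reach p xo k0) : y ∈ Reach p xo k0 := by
  obtain ⟨k, hk, hk'⟩ := hx
  exact ⟨k, hk, (dot_mono (hp k) h).trans_lt hk'⟩

/-- approximate common supporting price at a boundary point of the reached set -/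
lemma reach_price (hL : 0 < L) {R : Pref L} (hP : IsPref R) (hC : ContPref R)
    (hM : MonoStrong R) (hSC : PrefStrictConvex R)
    {p xo : ℕ → Fin L → ℝ} (hp : ∀ k, posv (p k))
    (hdense : ∀ q : Fin L → ℝ, posv q → ∀ ε : ℝ, 0 < ε → ∃ k, ‖p k - q‖ < ε)
    (hdem : ∀ k, IsDemand R (p k) (xo k)) {k0 : ℕ}
    {x : Fin L → ℝ} (hx : posv x)
    (hxT' : ∀ s : ℝ, 0 < s → s < 1 → (1 - s) • x ∈ Reach p xo k0) {τ : ℝ} (hτ : 0 < τ) :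
    ∃ k, dot (p k) x ≤ 1 + τ ∧ (∀ y, y ∉ Reach p xo k0 → 1 ≤ dot (p k) y) ∧
      ∀ y, nneg y → R y x → 1 ≤ dot (p k) y := by
  set s := τ / (2 * (1 + τ)) with hs
  have hs0 : 0 < s := by positivity
  have hs2 : (1 - 2 * s) * (1 + τ) = 1 := by rw [hs]; field_simp; ring
  have hs3 : 0 < 1 - 2 * s := by
    by_contra h
    push Not at h
    nlinarith
  obtain ⟨k, ⟨hk1, hk2⟩, hk3⟩ := obs_dense hL hP hC hM hSC hp hdense hdem
    (x := (1 - s) • x) (fun i => mul_pos (by linarith) (hx i))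
    (((isOpen_gt ((1 - 2 * s) • x)).inter (isOpen_lt' x)).inter (isOpen_reach p xo k0))
    ⟨⟨fun i => by
        have := hx i
        simp only [Pi.smul_apply, smul_eq_mul]; nlinarith,
      fun i => by
        have := hx i
        simp only [Pi.smul_apply, smul_eq_mul]; nlinarith⟩, hxT' s hs0 (by linarith)⟩
  have hw := fun k => demand_walras hL hP hM (hp k) (hdem k)
  obtain ⟨k', hk', hlt⟩ := hk3
  have hch : Relation.ReflTransGen (ObsStep p xo) k0 k := hk'.tail (by
    unfold ObsStep; rw [hw k']; exact hlt)
  refine ⟨k, ?_, ?_, ?_⟩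
  · have h1 := dot_mono (hp k) (fun i => (hk1 i).le)
    rw [dot_smul', hw k] at h1
    nlinarith
  · intro y hy
    by_contra h
    push Not at h
    exact hy ⟨k, hch, h⟩
  · intro y hy hyx
    exact demand_support hL hP hM (hp k) (hdem k) hy (hP.2 _ _ _ hyx
      (R_of_ge hP hM (hdem k).1.1 (fun i => (hk2 i).le)))

/-- the boundary curve of the reached set inside the cone spanned by two bundles -/
lemma reach_boundary {p xo : ℕ → Fin L → ℝ} (hp : ∀ k, posv (p k)) {k0 : ℕ}
    (hw : dot (p k0) (xo k0) = 1) (ha : posv (xo k0)) {b : Fin L → ℝ}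
    (hbT : b ∉ Reach p xo k0) (α : ℝ) (hα0 : 0 ≤ α) (hα1 : α ≤ 1) :
    ∃ β : ℝ, 0 ≤ β ∧ β ≤ 1 ∧ α • xo k0 + β • b ∉ Reach p xo k0 ∧
      ∀ s : ℝ, 0 < s → s < 1 → (1 - s) • (α • xo k0 + β • b) ∈ Reach p xo k0 := by
  have hcont : Continuous (fun β : ℝ => α • xo k0 + β • b) := by fun_prop
  have hcomp : IsCompact (Set.Icc (0:ℝ) 1 ∩
      (fun β : ℝ => α • xo k0 + β • b) ⁻¹' (Reach p xo k0)ᶜ) :=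
    isCompact_Icc.inter_right ((isOpen_reach p xo k0).isClosed_compl.preimage hcont)
  obtain ⟨β, ⟨⟨hβ0, hβ1⟩, hβT⟩, hmin⟩ := hcomp.exists_isLeast ⟨1, by simp, by
    intro h
    refine hbT (reach_down hp (fun i => ?_) h)
    have := mul_nonneg hα0 (ha i).le
    simp; linarith⟩
  refine ⟨β, hβ0, hβ1, hβT, ?_⟩
  intro s hs0 hs1
  rcases hβ0.eq_or_lt with h | h
  · subst h
    refine ⟨k0, Relation.ReflTransGen.refl, ?_⟩
    rw [dot_smul', dot_add', dot_smul', dot_smul', hw]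
    nlinarith
  · by_contra hcon
    have hmem : (1 - s) * β ∈ Set.Icc (0:ℝ) 1 ∩
      (fun β : ℝ => α • xo k0 + β • b) ⁻¹' (Reach p xo k0)ᶜ := by
      refine ⟨⟨by nlinarith, by nlinarith⟩, fun h' => hcon (reach_down hp (fun i => ?_) h')⟩
      have h1 := mul_nonneg (mul_nonneg hα0 hs0.le) (ha i).le
      have h2 := (ha i).le
      simp only [Pi.add_apply, Pi.smul_apply, smul_eq_mul]
      nlinarith
    have := hmin hmem
    nlinarith

lemma num_step {A0 B0 A1 B1 α0 α1 β0 β1 η τ Bh : ℝ} (hη : α0 - α1 = η)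
    (hB0 : 1 ≤ B0) (hB1 : 1 ≤ B1) (hBh : B1 ≤ Bh) (hτ : 0 < τ)
    (h00 : α0 * A0 + β0 * B0 ≤ 1 + τ) (h10 : 1 ≤ α1 * A0 + β1 * B0)
    (h11 : α1 * A1 + β1 * B1 ≤ 1 + τ) (h01 : 1 ≤ α0 * A1 + β0 * B1) :
    0 < Bh * ((A1 / B1 - A0 / B0) * η) + τ * (2 * Bh + 1) ∧
    α0 * A1 + β0 * B1 ≤ 1 + (Bh * ((A1 / B1 - A0 / B0) * η) + τ * (2 * Bh + 1)) := by
  obtain ⟨c0, hc0⟩ : ∃ c, c = A0 / B0 := ⟨_, rfl⟩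
  obtain ⟨c1, hc1⟩ : ∃ c, c = A1 / B1 := ⟨_, rfl⟩
  have hA0 : A0 = c0 * B0 := by rw [hc0]; field_simp
  have hA1 : A1 = c1 * B1 := by rw [hc1]; field_simp
  rw [← hc0, ← hc1]
  clear hc0 hc1
  subst hA0 hA1 hη
  set Q := c1 * (α0 - α1) + β0 - β1 with hQ
  have hQ1 : -τ ≤ B1 * Q := by rw [hQ]; nlinarith
  have hQ2 : -τ ≤ Q := by
    by_contra h
    push Not at h
    nlinarith
  set P := c0 * (α0 - α1) + β0 - β1 with hPd
  have hP1 : B0 * P ≤ τ := by rw [hPd]; nlinarith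
  have hP2 : P ≤ τ := by
    by_contra h
    push Not at h
    nlinarith
  set V := (c1 - c0) * (α0 - α1) + 2 * τ with hV
  have hVQ : Q + τ ≤ V := by rw [hV, hQ]; rw [hPd] at hP2; linarith
  have hV0 : 0 ≤ V := by linarith
  have e1 : Bh * ((c1 - c0) * (α0 - α1)) + τ * (2 * Bh + 1) = Bh * V + τ := by rw [hV]; ring
  rw [e1]
  have h1 : B1 * V ≤ Bh * V := mul_le_mul_of_nonneg_right hBh hV0
  have h2 : B1 * Q ≤ B1 * V := mul_le_mul_of_nonneg_left (by linarith) (by linarith)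
  have h3 : 0 ≤ Bh * V := mul_nonneg (by linarith) hV0
  refine ⟨by linarith, ?_⟩
  have e2 : α0 * (c1 * B1) + β0 * B1 = B1 * Q + (α1 * (c1 * B1) + β1 * B1) := by rw [hQ]; ring
  linarith

lemma exists_lower (hL : 0 < L) {b : Fin L → ℝ} (hb : posv b) : ∃ bm, 0 < bm ∧ ∀ i, bm ≤ b i := by
  obtain ⟨i, _, hi⟩ := Finset.exists_min_image Finset.univ b ⟨⟨0, hL⟩, Finset.mem_univ _⟩
  exact ⟨b i, hb i, fun j => hi j (Finset.mem_univ _)⟩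

lemma le_norm' (b : Fin L → ℝ) (i : Fin L) : b i ≤ ‖b‖ :=
  (le_abs_self _).trans (norm_le_pi_norm b i)

set_option maxHeartbeats 1000000 in
/-- Recoverability: whatever is strictly worse than an observed interior bundle is reached. -/
lemma core (hL : 0 < L) {R : Pref L} (hP : IsPref R) (hC : ContPref R)
    (hM : MonoStrong R) (hSC : PrefStrictConvex R) (hLip : Lipschitzian R)
    {p xo : ℕ → Fin L → ℝ} (hp : ∀ k, posv (p k))
    (hdense : ∀ q : Fin L → ℝ, posv q → ∀ ε : ℝ, 0 < ε → ∃ k, ‖p k - q‖ < ε)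
    (hdem : ∀ k, IsDemand R (p k) (xo k)) {k0 : ℕ} (ha : posv (xo k0))
    {b : Fin L → ℝ} (hb : posv b) (hab : ¬ R b (xo k0)) : b ∈ Reach p xo k0 := by
  by_contra hbT
  obtain ⟨a, ha_def⟩ : ∃ a, a = xo k0 := ⟨_, rfl⟩
  have hw0 := demand_walras hL hP hM (hp k0) (hdem k0)
  have hbd := reach_boundary hp hw0 ha hbT
  have ha1 : 1 ≤ dot (p k0) a := by rw [ha_def, hw0]
  have ha1' : dot (p k0) a = 1 := by rw [ha_def, hw0]
  rw [← ha_def] at ha hab hbd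
  obtain ⟨bm, hbm, hbb⟩ := exists_lower hL hb
  obtain ⟨am, ham, haa⟩ := exists_lower hL ha
  have hbn : 0 < ‖b‖ := (hb ⟨0, hL⟩).trans_le (le_norm' b _)
  -- a ≤ M b
  obtain ⟨M, hM0, haM⟩ : ∃ M : ℝ, 0 < M ∧ ∀ i, a i ≤ M * b i := by
    refine ⟨‖a‖ / bm + 1, by positivity, fun i => ?_⟩
    have h1 : ‖a‖ = ‖a‖ / bm * bm := by field_simp
    have h2 : ‖a‖ / bm * bm ≤ ‖a‖ / bm * b i := mul_le_mul_of_nonneg_left (hbb i) (by positivity)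
    have := le_norm' a i
    have := hb i
    linarith
  have hB0 : 0 < dot (p k0) b := dot_pos' hL (hp k0) hb
  -- uniform lower bound
  obtain ⟨c, hc0, hclow⟩ : ∃ c : ℝ, 0 < c ∧ ∀ α β : ℝ, 0 ≤ α → 0 ≤ β →
      α • a + β • b ∉ Reach p xo k0 → ∀ i, c * b i ≤ (α • a + β • b) i := by
    refine ⟨min (am / ‖b‖) (1 / dot (p k0) b), lt_min (by positivity) (by positivity), ?_⟩
    intro α β hα hβ hT i
    have h1 : 1 ≤ dot (p k0) (α • a + β • b) := by
      by_contra h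
      push Not at h
      exact hT ⟨k0, Relation.ReflTransGen.refl, h⟩
    rw [dot_add', dot_smul', dot_smul', ha1', mul_one] at h1
    set c := min (am / ‖b‖) (1 / dot (p k0) b) with hc
    have hc0 : 0 < c := lt_min (by positivity) (by positivity)
    have hca : c * b i ≤ a i := by
      calc c * b i ≤ am / ‖b‖ * ‖b‖ :=
            mul_le_mul (min_le_left _ _) (le_norm' b i) (hb i).le (by positivity)
        _ = am := by field_simp
        _ ≤ a i := haa i
    have hcb : c * dot (p k0) b ≤ 1 := by
      have := mul_le_mul_of_nonneg_right (min_le_right (am / ‖b‖) (1 / dot (p k0) b)) hB0.le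
      rwa [div_mul_cancel₀ _ hB0.ne'] at this
    have h2 : c ≤ α * c + β := by nlinarith
    have h3 : α * (c * b i) ≤ α * a i := mul_le_mul_of_nonneg_left hca hα
    have h4 : c * b i ≤ (α * c + β) * b i := mul_le_mul_of_nonneg_right h2 (hb i).le
    simp only [Pi.add_apply, Pi.smul_apply, smul_eq_mul]
    linarith
  -- slack level
  obtain ⟨s, hs0, hRs⟩ : ∃ s : ℝ, 0 < s ∧ R a ((1 + s) • b) := by
    have hcont : Continuous (fun s : ℝ => (1 + s) • b) := by fun_prop
    have h1 := hcont.continuousAt.preimage_mem_nhds (x := 0)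
      ((hC a).1.isOpen_compl.mem_nhds (show ((1 + (0:ℝ)) • b) ∈ {y | R y a}ᶜ by simpa using hab))
    have h2 : ∀ᶠ s : ℝ in nhdsWithin 0 (Set.Ioi 0), ¬ R ((1 + s) • b) a :=
      nhdsWithin_le_nhds h1
    have h3 : ∀ᶠ s : ℝ in nhdsWithin 0 (Set.Ioi 0), 0 < s := self_mem_nhdsWithin
    obtain ⟨s, hs, hs0⟩ := (h2.and h3).exists
    exact ⟨s, hs0, (hP.1 _ _ ha.nn (fun i => mul_nonneg (by linarith) (hb i).le)).resolve_right hs⟩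
  -- the box
  obtain ⟨r, hr0, hbox⟩ : ∃ r : ℝ, 0 < r ∧ ∀ w : Fin L → ℝ,
      (∀ i, min (c / 2) 1 * b i ≤ w i) → (∀ i, w i ≤ (M + 2 + 2 * s) * b i) → InBox r w := by
    set l := min (c / 2) 1 * bm with hl
    have hmin0 : 0 < min (c / 2) 1 := lt_min (by positivity) one_pos
    have hl0 : 0 < l := mul_pos hmin0 hbm
    refine ⟨1 / l + (M + 2 + 2 * s) * ‖b‖, by positivity, fun w h1 h2 i => ⟨?_, ?_⟩⟩
    · have h3 : l ≤ w i := (mul_le_mul_of_nonneg_left (hbb i) hmin0.le).trans (h1 i)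
      refine le_trans ?_ h3
      have h4 : 1 / l ≤ 1 + (1 / l + (M + 2 + 2 * s) * ‖b‖) := by
        have : 0 ≤ (M + 2 + 2 * s) * ‖b‖ := by positivity
        linarith
      have h5 := inv_anti₀ (by positivity) h4
      simpa using h5
    · have h3 : (M + 2 + 2 * s) * b i ≤ (M + 2 + 2 * s) * ‖b‖ :=
        mul_le_mul_of_nonneg_left (le_norm' b i) (by positivity)
      have h4 : 0 < 1 / l := by positivity
      have := h2 i
      linarith
  obtain ⟨K, hK, e, he, hLip'⟩ := hLip r hr0
  set X := (M + 1) * ‖b‖ with hX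
  have hX0 : 0 < X := by positivity
  obtain ⟨κ, hκ0, hκX⟩ : ∃ κ : ℝ, 0 < κ ∧ K * X < κ * bm :=
    ⟨K * X / bm + 1, by positivity, by rw [add_mul, div_mul_cancel₀ _ hbm.ne']; linarith⟩
  obtain ⟨Bh, hBh⟩ : ∃ Bh : ℝ, Bh = 2 / c := ⟨_, rfl⟩
  have hBh0 : 0 < Bh := by rw [hBh]; positivity
  set G := Bh * M + (2 * Bh + 1) with hG
  have hG0 : 0 < G := by positivity
  obtain ⟨N, hN⟩ := exists_nat_gt (κ * G / s + κ * G + κ * G * ‖b‖ / e + G + 1)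
  have t1 : 0 < κ * G / s := by positivity
  have t2 : 0 < κ * G := by positivity
  have t3 : 0 < κ * G * ‖b‖ / e := by positivity
  have hN0 : (0:ℝ) < N := by linarith
  have hN1 : (1:ℝ) ≤ N := by linarith
  have b1 : κ * (G / N) < s := by
    rw [← mul_div_assoc, div_lt_iff₀ hN0, mul_comm s, ← div_lt_iff₀ hs0]; linarith
  have b2 : κ * (G / N) ≤ 1 := by
    rw [← mul_div_assoc, div_le_iff₀ hN0]; linarith
  have b3 : κ * (G / N) * ‖b‖ < e := by
    have : κ * (G / N) * ‖b‖ = κ * G * ‖b‖ / N := by ring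
    rw [this, div_lt_iff₀ hN0, mul_comm e, ← div_lt_iff₀ he]; linarith
  have b4 : G / N ≤ 1 := by rw [div_le_iff₀ hN0]; linarith
  obtain ⟨τ, hτ⟩ : ∃ τ : ℝ, τ = 1 / (N * N) := ⟨_, rfl⟩
  have hτ0 : 0 < τ := by rw [hτ]; positivity
  have hτN : τ * N = 1 / N := by rw [hτ]; field_simp
  have hτ1 : τ ≤ 1 := by
    rw [hτ, div_le_one (by positivity)]; nlinarith
  have hτ2 : τ ≤ 1 / N := by rw [← hτN]; nlinarith
  -- the points
  have hpts : ∀ j : ℕ, ∃ (β : ℝ) (k : ℕ), j ≤ N →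
      0 ≤ β ∧ β ≤ 1 ∧ (1 - (j:ℝ) / N) • a + β • b ∉ Reach p xo k0 ∧
      (∀ i, c * b i ≤ ((1 - (j:ℝ) / N) • a + β • b) i) ∧
      (∀ i, ((1 - (j:ℝ) / N) • a + β • b) i ≤ (M + 1) * b i) ∧
      dot (p k) ((1 - (j:ℝ) / N) • a + β • b) ≤ 1 + τ ∧
      (∀ y, y ∉ Reach p xo k0 → 1 ≤ dot (p k) y) ∧
      ∀ y, nneg y → R y ((1 - (j:ℝ) / N) • a + β • b) → 1 ≤ dot (p k) y := by
    intro j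
    by_cases hj : j ≤ N
    swap
    · exact ⟨0, 0, fun h => absurd h hj⟩
    have hjN : (j:ℝ) / N ≤ 1 := by
      rw [div_le_one hN0]; exact_mod_cast hj
    have hj0 : 0 ≤ (j:ℝ) / N := by positivity
    obtain ⟨β, hβ0, hβ1, hT, hT'⟩ := hbd (1 - (j:ℝ) / N) (by linarith) (by linarith)
    have hlow := hclow _ β (by linarith) hβ0 hT
    obtain ⟨k, hk1, hk2, hk3⟩ := reach_price hL hP hC hM hSC hp hdense hdem
      (fun i => (mul_pos hc0 (hb i)).trans_le (hlow i)) hT' hτ0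
    refine ⟨β, k, fun _ => ⟨hβ0, hβ1, hT, hlow, fun i => ?_, hk1, hk2, hk3⟩⟩
    have h1 : (1 - (j:ℝ) / N) * a i ≤ 1 * (M * b i) :=
      mul_le_mul (by linarith) (haM i) (ha i).le (by norm_num)
    have h2 : β * b i ≤ 1 * b i := mul_le_mul_of_nonneg_right hβ1 (hb i).le
    simp only [Pi.add_apply, Pi.smul_apply, smul_eq_mul]
    linarith
  choose β k hpt using hpts
  set x : ℕ → Fin L → ℝ := fun j => (1 - (j:ℝ) / N) • a + β j • b with hx
  set cc : ℕ → ℝ := fun j => dot (p (k j)) a / dot (p (k j)) b with hcc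
  have hBl : ∀ j, j ≤ N → 1 ≤ dot (p (k j)) b := fun j hj =>
    (hpt j hj).2.2.2.2.2.2.1 b hbT
  have hBu : ∀ j, j ≤ N → dot (p (k j)) b ≤ Bh := fun j hj => by
    obtain ⟨_, _, _, hlow, _, hpx, _, _⟩ := hpt j hj
    have h1 := dot_mono (hp (k j)) (x := c • b) hlow
    rw [dot_smul'] at h1
    rw [hBh, le_div_iff₀ hc0]
    linarith
  have hcc0 : ∀ j, 0 ≤ cc j := fun j =>
    div_nonneg (dot_nonneg' (hp _) ha.nn) (dot_nonneg' (hp _) hb.nn)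
  have hccM : ∀ j, cc j ≤ M := fun j => by
    simp only [hcc]
    rw [div_le_iff₀ (dot_pos' hL (hp _) hb), ← dot_smul']
    exact dot_mono (hp _) haM
  have hdx : ∀ i j, dot (p (k i)) (x j) =
      (1 - (j:ℝ) / N) * dot (p (k i)) a + β j * dot (p (k i)) b := fun i j => by
    simp only [hx]; rw [dot_add', dot_smul', dot_smul']
  have hccd : ∀ i j, |cc i - cc j| ≤ M := fun i j => by
    rw [abs_le]; constructor <;> linarith [hcc0 i, hcc0 j, hccM i, hccM j]
  have hsum : ∀ i j l : ℕ, l ≤ N →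
      |Bh * ((cc i - cc j) * (1 / N)) + l * (τ * (2 * Bh + 1))| ≤ G / N := by
    intro i j l hl
    have h0 : (0:ℝ) < 1 / N := by positivity
    have h1 : |Bh * ((cc i - cc j) * (1 / N))| ≤ Bh * (M * (1 / N)) := by
      rw [abs_mul, abs_mul, abs_of_pos hBh0, abs_of_pos h0]
      gcongr
      exact hccd i j
    have h2 : |(l:ℝ) * (τ * (2 * Bh + 1))| ≤ 1 / N * (2 * Bh + 1) := by
      rw [abs_of_nonneg (by positivity), ← mul_assoc]
      have : (l:ℝ) * τ ≤ 1 / N := by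
        rw [← hτN, mul_comm]
        exact mul_le_mul_of_nonneg_left (by exact_mod_cast hl) hτ0.le
      gcongr
    refine (abs_add_le _ _).trans ?_
    have : G / N = Bh * (M * (1 / N)) + 1 / N * (2 * Bh + 1) := by rw [hG]; ring
    linarith
  -- induction on levels
  have hind : ∀ j : ℕ, j ≤ N → R (x j)
      (((1 + s) - κ * (Bh * ((cc j - cc 0) * (1 / N)) + j * (τ * (2 * Bh + 1)))) • b) := by
    intro j
    induction j with
    | zero =>
      intro _
      simp only [sub_self, zero_mul, mul_zero, Nat.cast_zero, add_zero, sub_zero]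
      refine hP.2 _ _ _ (R_of_ge hP hM ha.nn (fun i => ?_)) hRs
      have := mul_nonneg (hpt 0 (Nat.zero_le _)).1 (hb i).le
      simp [hx, this]
    | succ j ih =>
      intro hj
      have hj' : j ≤ N := by omega
      have hR := ih hj'
      obtain ⟨hβ0, hβ1, hT, hlow, hhigh, hpx, hnT, hsup⟩ := hpt j hj'
      obtain ⟨hβ0', hβ1', hT', hlow', hhigh', hpx', hnT', hsup'⟩ := hpt (j+1) hj
      obtain ⟨hD0, hDle⟩ := num_step (A0 := dot (p (k j)) a) (B0 := dot (p (k j)) b)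
        (A1 := dot (p (k (j+1))) a) (B1 := dot (p (k (j+1))) b)
        (α0 := 1 - (j:ℝ) / N) (α1 := 1 - ((j + 1 : ℕ) : ℝ) / N) (β0 := β j) (β1 := β (j+1))
        (η := 1 / N) (τ := τ) (Bh := Bh) (by push_cast; ring) (hBl j hj') (hBl _ hj) (hBu _ hj) hτ0
        (by rw [← hdx]; exact hpx) (by rw [← hdx]; exact hnT _ hT')
        (by rw [← hdx]; exact hpx') (by rw [← hdx]; exact hnT' _ hT)
      rw [← hdx] at hDle
      obtain ⟨D, hD⟩ : ∃ D, D = Bh * ((cc (j+1) - cc j) * (1 / N)) + τ * (2 * Bh + 1) := ⟨_, rfl⟩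
      have hD0 : 0 < D := by rw [hD]; exact hD0
      have hDle : dot (p (k (j+1))) (x j) ≤ 1 + D := by rw [hD]; exact hDle
      have hDG : D ≤ G / N := by
        have := (abs_le.1 (hsum (j+1) j 1 (by omega))).2
        rw [hD]
        simpa using this
      have hκD : κ * D ≤ κ * (G / N) := mul_le_mul_of_nonneg_left hDG hκ0.le
      obtain ⟨m, hm⟩ : ∃ m, m = (1 + s) - κ * (Bh * ((cc j - cc 0) * (1 / N))
        + j * (τ * (2 * Bh + 1))) := ⟨_, rfl⟩
      have hm' : m - κ * D = (1 + s) - κ * (Bh * ((cc (j+1) - cc 0) * (1 / N))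
        + (j + 1 : ℕ) * (τ * (2 * Bh + 1))) := by rw [hm, hD]; push_cast; ring
      rw [← hm] at hR
      rw [← hm']
      have hS1 := mul_le_mul_of_nonneg_left (abs_le.1 (hsum (j+1) 0 (j+1) hj)).2 hκ0.le
      have hS2 := mul_le_mul_of_nonneg_left (abs_le.1 (hsum j 0 j hj')).1 hκ0.le
      have hxp : ∀ w : Fin L → ℝ, (∀ i, c * b i ≤ w i) → posv w :=
        fun w hw i => (mul_pos hc0 (hb i)).trans_le (hw i)
      have hmin1 : min (c / 2) 1 ≤ c / 2 := min_le_left _ _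
      have hmin2 : min (c / 2) 1 ≤ 1 := min_le_right _ _
      refine level_step hL hP hC hM hK hLip' hb hbm hbb (x := x j) (x' := x (j+1))
        (p := p (k (j+1))) (X := X) (hxp _ hlow) (hxp _ hlow').nn ?_ hD0 (hDG.trans b4) hκ0 hκX
        ?_ (hκD.trans b2) ?_ ?_ ?_ hR hDle hsup'
      · refine (pi_norm_le_iff_of_nonneg hX0.le).2 (fun i => ?_)
        rw [Real.norm_eq_abs, abs_of_pos (hxp _ hlow i)]
        exact (hhigh i).trans (mul_le_mul_of_nonneg_left (le_norm' b i) (by positivity))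
      · rw [hm']
        linarith
      · exact (mul_le_mul_of_nonneg_right hκD hbn.le).trans_lt b3
      · intro μ hμ1 hμ2
        refine hbox _ (fun i => ?_) (fun i => ?_)
        · have h1 : min (c / 2) 1 * b i ≤ c / 2 * b i :=
            mul_le_mul_of_nonneg_right hmin1 (hb i).le
          have h2 : 1 / 2 * (c * b i) ≤ μ * x j i :=
            mul_le_mul hμ1 (hlow i) (mul_pos hc0 (hb i)).le (by linarith)
          simp only [Pi.smul_apply, smul_eq_mul]
          linarith
        · have h2 : μ * x j i ≤ 1 * ((M + 1) * b i) :=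
            mul_le_mul hμ2 (hhigh i) (hxp _ hlow i).le (by norm_num)
          have h3 : 0 < (1 + 2 * s) * b i := mul_pos (by linarith) (hb i)
          simp only [Pi.smul_apply, smul_eq_mul]
          linarith
      · intro μ hμ1 hμ2
        have hm2 : m ≤ 1 + 2 * s := by rw [hm]; linarith
        refine hbox _ (fun i => ?_) (fun i => ?_)
        · exact mul_le_mul_of_nonneg_right (hmin2.trans hμ1) (hb i).le
        · exact mul_le_mul_of_nonneg_right (by linarith) (hb i).le
  -- conclusion
  have hfin := hind N le_rfl
  obtain ⟨hβ0, hβ1, -⟩ := hpt N le_rfl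
  have hS := mul_le_mul_of_nonneg_left (abs_le.1 (hsum N 0 N le_rfl)).2 hκ0.le
  have hxN : x N = β N • b := by
    simp only [hx]; rw [div_self hN0.ne']; simp
  rw [hxN] at hfin
  refine (hM _ (β N • b) (fun i => mul_nonneg hβ0 (hb i).le) (fun i => ?_) ?_).2 hfin
  · exact mul_le_mul_of_nonneg_right (by linarith) (hb i).le
  · intro e'
    have h1 := congrFun e' ⟨0, hL⟩
    simp only [Pi.smul_apply, smul_eq_mul] at h1
    have h2 := mul_right_cancel₀ (hb ⟨0, hL⟩).ne' h1
    linarith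

lemma chain_of_rtg {S : ℕ → ℕ → Prop} {k0 k : ℕ} (h : Relation.ReflTransGen S k0 k) :
    ∃ N : ℕ, ∃ idx : Fin (N + 1) → ℕ, idx 0 = k0 ∧ idx (Fin.last N) = k ∧
      ∀ j : Fin N, S (idx j.castSucc) (idx j.succ) := by
  induction h using Relation.ReflTransGen.head_induction_on with
  | refl => exact ⟨0, fun _ => k, rfl, rfl, fun j => j.elim0⟩
  | @head a c hab _ ih =>
    obtain ⟨N, idx, h0, h1, h2⟩ := ih
    refine ⟨N + 1, Fin.cons a idx, rfl, ?_, ?_⟩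
    · rw [← Fin.succ_last, Fin.cons_succ, h1]
    · intro j
      refine Fin.cases ?_ (fun j => ?_) j
      · simpa [h0] using hab
      · rw [Fin.cons_succ, Fin.castSucc_succ, Fin.cons_succ]
        exact h2 j

/-- Theorem 2: the revealed demand correspondence shrinks to an
ε-neighborhood of true demand after finitely many observations. -/
theorem statement9 (hL : 0 < L) (R : Pref L)
    (hP : IsPref R) (hC : ContPref R) (hM : MonoStrong R) (hSC : PrefStrictConvex R)
    (hLip : Lipschitzian R)
    (p xo : ℕ → Fin L → ℝ) (hp : ∀ k, posv (p k))
    (hdense : ∀ q : Fin L → ℝ, posv q → ∀ ε : ℝ, 0 < ε → ∃ k, ‖p k - q‖ < ε)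
    (hdem : ∀ k, IsDemand R (p k) (xo k))
    (q : Fin L → ℝ) (hq : posv q) (xstar : Fin L → ℝ) (hstar : IsDemand R q xstar)
    (ε : ℝ) (hε : 0 < ε) :
    ∃ n : ℕ, ∀ x ∈ RevDemand p xo n q, Budget q x ∧ ‖xstar - x‖ ≤ ε := by
  have hw := fun k => demand_walras hL hP hM (hp k) (hdem k)
  have hcomp : IsCompact {x : Fin L → ℝ | nneg x ∧ dot q x = 1 ∧ ε ≤ ‖xstar - x‖} := by
    have hsub : {x : Fin L → ℝ | nneg x ∧ dot q x = 1 ∧ ε ≤ ‖xstar - x‖} ⊆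
        Set.pi Set.univ (fun i => Set.Icc (0 : ℝ) (1 / q i)) := by
      rintro x ⟨h0, h1, _⟩ i _
      refine ⟨h0 i, ?_⟩
      have h2 : q i * x i ≤ dot q x :=
        Finset.single_le_sum (f := fun i => q i * x i)
          (fun j _ => mul_nonneg (hq j).le (h0 j)) (Finset.mem_univ i)
      rw [le_div_iff₀ (hq i)]
      linarith
    refine (isCompact_univ_pi (fun i => isCompact_Icc)).of_isClosed_subset ?_ hsub
    exact isClosed_nneg.inter ((isClosed_eq (dot_cont q) continuous_const).inter
      (isClosed_le continuous_const (continuous_const.sub continuous_id).norm))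
  have key : ∃ n : ℕ, ∀ x ∈ {x : Fin L → ℝ | nneg x ∧ dot q x = 1 ∧ ε ≤ ‖xstar - x‖},
      ∃ x', nneg x' ∧ dot q x' ≤ 1 ∧ RevChain p xo n x' x := by
    refine hcomp.induction_on (p := fun S => ∃ n : ℕ, ∀ x ∈ S,
      ∃ x', nneg x' ∧ dot q x' ≤ 1 ∧ RevChain p xo n x' x) ?_ ?_ ?_ ?_
    · exact ⟨0, fun x hx => hx.elim⟩
    · rintro s t hst ⟨n, hn⟩
      exact ⟨n, fun x hx => hn x (hst hx)⟩
    · rintro s t ⟨n, hn⟩ ⟨n', hn'⟩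
      have up : ∀ {m m' : ℕ} {x : Fin L → ℝ}, m ≤ m' →
          (∃ x', nneg x' ∧ dot q x' ≤ 1 ∧ RevChain p xo m x' x) →
          ∃ x', nneg x' ∧ dot q x' ≤ 1 ∧ RevChain p xo m' x' x := by
        rintro m m' x hmm ⟨x', h1, h2, N, idx, h3, h4⟩
        exact ⟨x', h1, h2, N, idx, fun j => (h3 j).trans_le hmm, h4⟩
      refine ⟨max n n', ?_⟩
      rintro x (hx | hx)
      · exact up (le_max_left _ _) (hn x hx)
      · exact up (le_max_right _ _) (hn' x hx)
    · rintro x0 ⟨hx0, hqx0, hfar⟩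
      have hne : x0 ≠ xstar := by
        rintro rfl
        simp at hfar; linarith
      have hnR : ¬ R x0 xstar := by
        intro hR
        have h1 := hSC x0 xstar hx0 hstar.1.1 hR hne (1/2) (by norm_num) (by norm_num)
        refine h1.2 (hstar.2 _ ⟨fun i => ?_, ?_⟩)
        · have := hx0 i
          have := hstar.1.1 i
          simp only [Pi.add_apply, Pi.smul_apply, smul_eq_mul]; linarith
        · have := hstar.1.2
          rw [dot_add', dot_smul', dot_smul', hqx0]; linarith
      have hpos1 : ∀ᶠ s : ℝ in nhdsWithin 0 (Set.Ioi 0), 0 < s := self_mem_nhdsWithin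
      have hlt1 : ∀ᶠ s : ℝ in nhdsWithin 0 (Set.Ioi 0), s < 1 :=
        nhdsWithin_le_nhds (gt_mem_nhds one_pos)
      -- a strictly larger bundle still worse than demand
      obtain ⟨b, hbx, hbR⟩ : ∃ b : Fin L → ℝ, (∀ i, x0 i < b i) ∧ ¬ R b xstar := by
        have hcont : Continuous (fun s : ℝ => x0 + s • (1 : Fin L → ℝ)) := by fun_prop
        have h1 := hcont.continuousAt.preimage_mem_nhds (x := 0)
          ((hC xstar).1.isOpen_compl.mem_nhds
            (show (x0 + (0:ℝ) • (1 : Fin L → ℝ)) ∈ {y | R y xstar}ᶜ by simpa using hnR))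
        have h2 : ∀ᶠ s : ℝ in nhdsWithin 0 (Set.Ioi 0), ¬ R (x0 + s • (1 : Fin L → ℝ)) xstar :=
          nhdsWithin_le_nhds h1
        obtain ⟨s, hs, hs0⟩ := (h2.and hpos1).exists
        exact ⟨_, fun i => by simp [hs0], hs⟩
      have hb : posv b := fun i => (hx0 i).trans_lt (hbx i)
      -- an interior bundle inside the budget set that is still better
      obtain ⟨a, ha, hqa, haR⟩ : ∃ a : Fin L → ℝ, posv a ∧ dot q a < 1 ∧ ¬ R b a := by
        have he : 0 < dot q (1 : Fin L → ℝ) := dot_pos' hL hq (fun i => by simp)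
        obtain ⟨c, hc⟩ : ∃ c, c = 1 / (2 * dot q (1 : Fin L → ℝ)) := ⟨_, rfl⟩
        have hc0 : 0 < c := by rw [hc]; positivity
        have hce : c * dot q (1 : Fin L → ℝ) = 1 / 2 := by rw [hc]; field_simp
        have hcont : Continuous (fun s : ℝ => (1 - s) • xstar + s • (c • (1 : Fin L → ℝ))) := by
          fun_prop
        have h0 : ¬ R b xstar := hbR
        have h1 := hcont.continuousAt.preimage_mem_nhds (x := 0)
          ((hC b).2.isOpen_compl.mem_nhds
            (show ((1 - (0:ℝ)) • xstar + (0:ℝ) • (c • (1 : Fin L → ℝ))) ∈ {y | R b y}ᶜ by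
              simpa using hbR))
        have h2 : ∀ᶠ s : ℝ in nhdsWithin 0 (Set.Ioi 0),
            ¬ R b ((1 - s) • xstar + s • (c • (1 : Fin L → ℝ))) :=
          nhdsWithin_le_nhds h1
        obtain ⟨s, ⟨hs, hs0⟩, hs1⟩ := ((h2.and hpos1).and hlt1).exists
        refine ⟨_, fun i => ?_, ?_, hs⟩
        · have h3 := mul_nonneg (sub_nonneg.2 hs1.le) (hstar.1.1 i)
          have h4 := mul_pos hs0 hc0
          simp only [Pi.add_apply, Pi.smul_apply, smul_eq_mul, Pi.one_apply, mul_one]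
          linarith
        · have h3 := hstar.1.2
          rw [dot_add', dot_smul', dot_smul', dot_smul', hce]
          nlinarith
      obtain ⟨k0, ⟨hk1, hk2⟩, hk3⟩ := obs_dense hL hP hC hM hSC hp hdense hdem ha
        ((isOpen_posv.inter (isOpen_lt (dot_cont q) continuous_const)).inter
          (hC b).2.isOpen_compl) ⟨⟨ha, hqa⟩, haR⟩
      obtain ⟨k, hk, hkb⟩ := core hL hP hC hM hSC hLip hp hdense hdem hk1 hb hk3
      obtain ⟨l, hl1, hl2⟩ := obs_dense hL hP hC hM hSC hp hdense hdem hb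
        ((isOpen_gt x0).inter (isOpen_lt (dot_cont (p k)) continuous_const)) ⟨hbx, hkb⟩
      have hch : Relation.ReflTransGen (ObsStep p xo) k0 l := hk.tail (by
        unfold ObsStep; rw [hw k]; exact hl2)
      obtain ⟨N, idx, hi0, hi1, hi2⟩ := chain_of_rtg hch
      refine ⟨{x | ∀ i, x i < xo l i}, nhdsWithin_le_nhds ((isOpen_lt' _).mem_nhds hl1),
        Finset.univ.sup idx + 1, fun x hx => ⟨xo k0, (hdem k0).1.1, le_of_lt hk2, N, idx,
          fun j => Nat.lt_succ_of_le (Finset.le_sup (Finset.mem_univ j)), ?_, hi2, ?_⟩⟩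
      · intro i; rw [hi0]
      · intro i; rw [hi1]; exact (hx i).le
  obtain ⟨n, hn⟩ := key
  refine ⟨n, fun x hx => ⟨⟨hx.1, hx.2.1.le⟩, ?_⟩⟩
  by_contra hfar
  push Not at hfar
  exact hx.2.2 (hn x ⟨hx.1, hx.2.1, hfar.le⟩)

end Paper
end

section
/- Two continuous, monotone, strictly convex, Lipschitzian preference relations on ℝ^L_+ that generate the same Walrasian demand function on all of ℝ^L_{++} are equal (demand identifies Lipschitzian preferences). -/
namespace Paper

variable {L H : ℕ}

/-! ### Helper lemmas -/

theorem aux_refl {R : Pref L} (h : Regular R) {x : Fin L → ℝ} (hx : nneg x) : R x x := by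
  rcases h.1.1 x x hx hx with h | h <;> exact h

theorem aux_mono {R : Pref L} (h : Regular R) {u v : Fin L → ℝ} (hv : nneg v)
    (huv : ∀ i, v i ≤ u i) : R u v := by
  by_cases e : u = v
  · subst e; exact aux_refl h hv
  · exact (h.2.2.1 u v hv huv e).1

theorem aux_ivt {R : Pref L} (h : Regular R) {a b w : Fin L → ℝ} (ha : nneg a) (hb : nneg b)
    (hw : nneg w) (hbw : R b w) (hwa : R w a) :
    ∃ s : ℝ, 0 ≤ s ∧ s ≤ 1 ∧ R (a + s • (b - a)) w ∧ R w (a + s • (b - a)) := by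
  have hc : Continuous (fun s : ℝ => a + s • (b - a)) := by fun_prop
  have h1 := (h.2.1 w).1.preimage hc
  have h2 := (h.2.1 w).2.preimage hc
  have hn : ∀ s : ℝ, 0 ≤ s → s ≤ 1 → nneg (a + s • (b - a)) := by
    intro s h0 h1 i
    have := ha i
    have := hb i
    simp only [Pi.add_apply, Pi.smul_apply, Pi.sub_apply, smul_eq_mul]
    nlinarith [mul_nonneg h0 (hb i), mul_nonneg (sub_nonneg.2 h1) (ha i)]
  have key := isPreconnected_closed_iff.1 (isPreconnected_Icc (a := (0:ℝ)) (b := 1)) _ _ h1 h2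
    (by
      intro s hs
      rcases h.1.1 _ _ (hn s hs.1 hs.2) hw with h | h
      · exact Or.inl h
      · exact Or.inr h)
    ⟨1, by simp, by simpa using hbw⟩ ⟨0, by simp, by simpa using hwa⟩
  obtain ⟨s, hs, h3, h4⟩ := key
  exact ⟨s, hs.1, hs.2, h3, h4⟩

/-- `u` is the diagonal utility. -/
def DiagU (R : Pref L) (u : (Fin L → ℝ) → ℝ) : Prop :=
  ∀ z, nneg z → 0 ≤ u z ∧ R (fun _ => u z) z ∧ R z (fun _ => u z)

theorem aux_exU {R : Pref L} (h : Regular R) : ∃ u, DiagU R u := by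
  have : ∀ z : Fin L → ℝ, ∃ a : ℝ, nneg z →
      0 ≤ a ∧ R (fun _ => a) z ∧ R z (fun _ => a) := by
    intro z
    by_cases hz : nneg z
    · have hb : nneg (fun _ : Fin L => ‖z‖) := fun i => norm_nonneg z
      have h0 : nneg (0 : Fin L → ℝ) := fun i => le_refl _
      obtain ⟨s, hs0, hs1, h1, h2⟩ := aux_ivt h h0 hb hz
        (aux_mono h hz (fun i => (le_abs_self _).trans (norm_le_pi_norm z i)))
        (aux_mono h h0 hz)
      refine ⟨s * ‖z‖, fun _ => ⟨by positivity, ?_, ?_⟩⟩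
      · convert h1 using 1; ext i; simp
      · convert h2 using 1; ext i; simp
    · exact ⟨0, fun h => absurd h hz⟩
  choose u hu using this
  exact ⟨u, hu⟩

theorem aux_const {R : Pref L} (hL : 0 < L) (h : Regular R) {a b : ℝ} (ha : 0 ≤ a) (hb : 0 ≤ b) :
    R (fun _ => b) (fun _ => a) ↔ a ≤ b := by
  constructor
  · intro hR
    by_contra hab
    push Not at hab
    refine (h.2.2.1 (fun _ => a) (fun _ => b) (fun _ => hb) (fun _ => hab.le) ?_).2 hR
    intro e
    exact absurd (congrFun e ⟨0, hL⟩) hab.ne'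
  · intro hab
    exact aux_mono h (fun _ => ha) (fun _ => hab)

theorem aux_u_iff {R : Pref L} (hL : 0 < L) (h : Regular R) {u} (hu : DiagU R u)
    {x y : Fin L → ℝ} (hx : nneg x) (hy : nneg y) : R x y ↔ u y ≤ u x := by
  obtain ⟨a1, a2, a3⟩ := hu x hx
  obtain ⟨b1, b2, b3⟩ := hu y hy
  rw [← aux_const hL h b1 a1]
  exact ⟨fun hR => h.1.2 _ _ _ a2 (h.1.2 _ _ _ hR b3),
    fun hR => h.1.2 _ _ _ a3 (h.1.2 _ _ _ hR b2)⟩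

theorem aux_u_const {R : Pref L} (hL : 0 < L) (h : Regular R) {u} (hu : DiagU R u)
    {a : ℝ} (ha : 0 ≤ a) : u (fun _ => a) = a := by
  obtain ⟨a1, a2, a3⟩ := hu (fun _ => a) (fun _ => ha)
  exact le_antisymm ((aux_const hL h a1 ha).1 a3) ((aux_const hL h ha a1).1 a2)

theorem aux_u_cont {R : Pref L} (hL : 0 < L) (h : Regular R) {u} (hu : DiagU R u) :
    ContinuousOn u {z | nneg z} := by
  intro x hx
  have hx : nneg x := hx
  rw [ContinuousWithinAt, tendsto_order]
  constructor
  · intro a hax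
    by_cases ha : 0 ≤ a
    · have ho : IsOpen {w | R (fun _ => a) w}ᶜ := (h.2.1 _).2.isOpen_compl
      have hm : x ∈ {w | R (fun _ => a) w}ᶜ := by
        intro hR
        have := (aux_u_iff hL h hu (fun _ => ha) hx).1 hR
        rw [aux_u_const hL h hu ha] at this
        linarith
      filter_upwards [self_mem_nhdsWithin, mem_nhdsWithin_of_mem_nhds (ho.mem_nhds hm)]
        with z hz hz2
      by_contra hc
      apply hz2
      refine (aux_u_iff hL h hu (fun _ => ha) hz).2 ?_
      rw [aux_u_const hL h hu ha]
      linarith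
    · filter_upwards [self_mem_nhdsWithin] with z hz
      have := (hu z hz).1
      linarith
  · intro a hax
    have ha : 0 ≤ a := by linarith [(hu x hx).1]
    have ho : IsOpen {w | R w (fun _ => a)}ᶜ := (h.2.1 _).1.isOpen_compl
    have hm : x ∈ {w | R w (fun _ => a)}ᶜ := by
      intro hR
      have := (aux_u_iff hL h hu hx (fun _ => ha)).1 hR
      rw [aux_u_const hL h hu ha] at this
      linarith
    filter_upwards [self_mem_nhdsWithin, mem_nhdsWithin_of_mem_nhds (ho.mem_nhds hm)]
      with z hz hz2
    by_contra hc
    apply hz2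
    refine (aux_u_iff hL h hu hz (fun _ => ha)).2 ?_
    rw [aux_u_const hL h hu ha]
    linarith

theorem aux_u_lip {R : Pref L} (hL : 0 < L) (h : Regular R) (hLip : Lipschitzian R) {u}
    (hu : DiagU R u) {r : ℝ} (hr : 0 < r) :
    ∃ K : ℝ, 0 < K ∧ ∃ η : ℝ, 0 < η ∧ ∀ z z' : Fin L → ℝ, InBox r z → InBox r z' →
      ‖z - z'‖ < η → u z - u z' ≤ K * ‖z - z'‖ := by
  obtain ⟨K, hK, ε, hε, hlip⟩ := hLip r hr
  have hr1 : 0 < (1 + r)⁻¹ := by positivity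
  have hnn : ∀ z : Fin L → ℝ, InBox r z → nneg z := fun z hz i => hr1.le.trans (hz i).1
  have hcomp : IsCompact {z : Fin L → ℝ | InBox r z} := by
    have : {z : Fin L → ℝ | InBox r z} = Set.Icc (fun _ => (1 + r)⁻¹) (fun _ => 1 + r) := by
      ext z
      simp only [InBox, Set.mem_ofPred_eq, Set.mem_Icc, Pi.le_def]
      exact ⟨fun h => ⟨fun i => (h i).1, fun i => (h i).2⟩, fun h i => ⟨h.1 i, h.2 i⟩⟩
    rw [this]; exact isCompact_Icc
  have huc := hcomp.uniformContinuousOn_of_continuous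
    ((aux_u_cont hL h hu).mono (fun z hz => hnn z hz))
  obtain ⟨η, hη, hucη⟩ := Metric.uniformContinuousOn_iff.1 huc (min ε (1 + r)⁻¹) (by positivity)
  refine ⟨K, hK, η, hη, ?_⟩
  intro z z' hz hz' hzz
  by_cases hle : u z ≤ u z'
  · have : 0 ≤ K * ‖z - z'‖ := by positivity
    linarith
  push Not at hle
  have hbox : ∀ w : Fin L → ℝ, InBox r w → InBox r (fun _ : Fin L => u w) := by
    intro w hw i
    constructor
    · have := (aux_u_iff hL h hu (hnn w hw) (fun _ => hr1.le)).1
        (aux_mono h (fun _ => hr1.le) (fun i => (hw i).1))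
      rwa [aux_u_const hL h hu hr1.le] at this
    · have h1 : (0:ℝ) ≤ 1 + r := by positivity
      have := (aux_u_iff hL h hu (fun _ => h1) (hnn w hw)).1
        (aux_mono h (hnn w hw) (fun i => (hw i).2))
      rwa [aux_u_const hL h hu h1] at this
  have hd := hucη z hz z' hz' (by rwa [dist_eq_norm])
  rw [Real.dist_eq, abs_of_pos (by linarith), lt_min_iff] at hd
  obtain ⟨a1, a2, a3⟩ := hu z' (hnn z' hz')
  obtain ⟨b1, b2, b3⟩ := hu z (hnn z hz)
  have hX : ‖(fun _ : Fin L => u z') - (fun _ => u z)‖ < ε := by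
    rw [pi_norm_lt_iff hε]
    intro i
    simp only [Pi.sub_apply, Real.norm_eq_abs]
    rw [abs_sub_comm, abs_of_pos (by linarith)]
    exact hd.1
  have := hlip (fun _ => u z') z' (fun _ => u z) (hbox z' hz') hz' (hbox z hz) a2 a3 hX
  have h1 : Metric.infDist z' {w | R w (fun _ => u z)} ≤ ‖z - z'‖ := by
    have := Metric.infDist_le_dist_of_mem (x := z') (s := {w | R w (fun _ => u z)}) (y := z) b3
    rwa [dist_comm, dist_eq_norm] at this
  have h2 : u z - u z' ≤ Metric.infDist (fun _ => u z') {w | R w (fun _ => u z)} := by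
    rw [Metric.le_infDist ⟨z, b3⟩]
    intro w hw
    by_contra hc
    push Not at hc
    rw [dist_pi_lt_iff (by linarith)] at hc
    have hz'b := (hbox z' hz' ⟨0, hL⟩).1
    have hwi : ∀ i, 0 < w i ∧ w i < u z := by
      intro i
      have := hc i
      rw [Real.dist_eq, abs_lt] at this
      constructor <;> linarith
    refine (h.2.2.1 (fun _ => u z) w (fun i => (hwi i).1.le) (fun i => (hwi i).2.le) ?_).2 hw
    intro e
    exact absurd (congrFun e ⟨0, hL⟩) (hwi _).2.ne'
  calc u z - u z' ≤ _ := h2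
    _ ≤ _ := this
    _ ≤ _ := by gcongr

theorem aux_dot_add (p a b : Fin L → ℝ) : dot p (a + b) = dot p a + dot p b := by
  simp [dot, mul_add, Finset.sum_add_distrib]

theorem aux_dot_smul (p a : Fin L → ℝ) (c : ℝ) : dot p (c • a) = c * dot p a := by
  simp only [dot, Pi.smul_apply, smul_eq_mul, Finset.mul_sum]
  exact Finset.sum_congr rfl (fun i _ => by ring)

theorem aux_dot_pos (hL : 0 < L) {p a : Fin L → ℝ} (hp : posv p) (ha : posv a) : 0 < dot p a := by
  have : Nonempty (Fin L) := ⟨⟨0, hL⟩⟩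
  exact Finset.sum_pos (fun i _ => mul_pos (hp i) (ha i)) Finset.univ_nonempty

theorem aux_demand_unique {R : Pref L} (h : Regular R) {p a b : Fin L → ℝ}
    (ha : IsDemand R p a) (hb : IsDemand R p b) : a = b := by
  by_contra hne
  have h1 := h.2.2.2 a b ha.1.1 hb.1.1 (ha.2 b hb.1) hne (1/2) (by norm_num) (by norm_num)
  apply h1.2
  apply hb.2
  constructor
  · intro i
    have := ha.1.1 i
    have := hb.1.1 i
    simp only [Pi.add_apply, Pi.smul_apply, smul_eq_mul]
    linarith
  · rw [aux_dot_add, aux_dot_smul, aux_dot_smul]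
    linarith [ha.1.2, hb.1.2]

theorem aux_support {R : Pref L} (hL : 0 < L) (h : Regular R) {z : Fin L → ℝ} (hz : posv z) :
    ∃ p : Fin L → ℝ, posv p ∧ dot p z = 1 ∧ (∀ w, nneg w → R w z → 1 ≤ dot p w) ∧
      IsDemand R p z := by
  have hzn : nneg z := fun i => (hz i).le
  set S : Set (Fin L → ℝ) := {w | posv w} ∩ {w | R z w}ᶜ with hS
  have hSo : IsOpen S := by
    refine IsOpen.inter ?_ (h.2.1 z).2.isOpen_compl
    have : {w : Fin L → ℝ | posv w} = ⋂ i, {w | 0 < w i} := by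
      ext w; simp [posv]
    rw [this]
    exact isOpen_iInter_of_finite (fun i => isOpen_lt continuous_const (continuous_apply i))
  have hcv : ∀ a b : Fin L → ℝ, a ∈ S → b ∈ S → R a b → ∀ l : ℝ, 0 < l → l < 1 →
      l • a + (1 - l) • b ∈ S := by
    intro a b ha hb hab l h0 h1
    constructor
    · intro i
      have h2 := mul_pos h0 (ha.1 i)
      have h3 := mul_pos (sub_pos.2 h1) (hb.1 i)
      simpa using add_pos h2 h3
    · intro hR
      apply hb.2
      by_cases e : a = b
      · subst e
        have : l • a + (1 - l) • a = a := by rw [← add_smul]; simp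
        rwa [this] at hR
      · exact h.1.2 _ _ _ hR
          (h.2.2.2 a b (fun i => (ha.1 i).le) (fun i => (hb.1 i).le) hab e l h0 h1).1
  have hSc : Convex ℝ S := by
    rw [convex_iff_forall_pos]
    intro a ha b hb l m hl hm hlm
    rcases h.1.1 a b (fun i => (ha.1 i).le) (fun i => (hb.1 i).le) with hab | hab
    · have := hcv a b ha hb hab l hl (by linarith)
      rwa [show 1 - l = m by linarith] at this
    · have := hcv b a hb ha hab m hm (by linarith)
      rw [show 1 - m = l by linarith] at this
      rwa [add_comm]
  have hzS : z ∉ S := fun hh => hh.2 (aux_refl h hzn)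
  obtain ⟨g, hg⟩ := geometric_hahn_banach_open_point hSc hSo hzS
  set q : Fin L → ℝ := fun i => - g (Pi.single i 1) with hq
  have hgq : ∀ w, g w = - dot q w := by
    intro w
    have : w = ∑ i, w i • (Pi.single i (1:ℝ) : Fin L → ℝ) := by
      ext j
      simp [Finset.sum_apply, Pi.single_apply]
    conv_lhs => rw [this]
    rw [map_sum]
    simp only [map_smul, smul_eq_mul, dot, hq]
    rw [← Finset.sum_neg_distrib]
    exact Finset.sum_congr rfl (fun i _ => by ring)
  have hup : ∀ w, nneg w → R w z → ∀ v : Fin L → ℝ, nneg v → v ≠ 0 → posv (w + v) →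
      dot q z < dot q (w + v) := by
    intro w hw hwz v hv hv0 hp
    have hmem : w + v ∈ S := by
      refine ⟨hp, fun hR => ?_⟩
      refine (h.2.2.1 (w + v) w hw (fun i => by simpa using hv i) (by simpa using hv0)).2 ?_
      exact h.1.2 _ _ _ hwz hR
    have := hg _ hmem
    rw [hgq, hgq] at this
    linarith
  have hqpos : posv q := by
    intro i
    have h0 : nneg (Pi.single i (1:ℝ) : Fin L → ℝ) := by
      intro j
      by_cases e : j = i
      · subst e; simp
      · simp [e]
    have := hup z hzn (aux_refl h hzn) (Pi.single i 1) h0 (by simp) (by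
      intro j
      have := h0 j
      have := hz j
      simp only [Pi.add_apply]
      linarith)
    rw [aux_dot_add] at this
    have h2 : dot q (Pi.single i 1) = q i := by
      simp [dot, Pi.single_apply]
    linarith
  have hqz := aux_dot_pos hL hqpos hz
  have hone : posv (fun _ : Fin L => (1:ℝ)) := fun _ => one_pos
  have hge : ∀ w, nneg w → R w z → dot q z ≤ dot q w := by
    intro w hw hwz
    have hq1 := aux_dot_pos hL hqpos hone
    refine le_of_forall_pos_lt_add (fun ε hε => ?_)
    have hc : 0 < ε / dot q (fun _ => 1) := by positivity
    have := hup w hw hwz ((ε / dot q (fun _ => 1)) • (fun _ => 1)) (fun i => by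
        simpa using hc.le) (by
        intro e
        have := congrFun e ⟨0, hL⟩
        simp at this
        rcases this with h | h <;> linarith) (fun i => by
        have := hw i
        simp only [Pi.add_apply, Pi.smul_apply, smul_eq_mul, mul_one]
        linarith)
    rw [aux_dot_add, aux_dot_smul] at this
    field_simp at this
    linarith
  have hdp : ∀ w, dot ((dot q z)⁻¹ • q) w = (dot q z)⁻¹ * dot q w := by
    intro w
    simp only [dot, Pi.smul_apply, smul_eq_mul, Finset.mul_sum]
    exact Finset.sum_congr rfl (fun i _ => by ring)
  have hsup : ∀ w, nneg w → R w z → 1 ≤ dot ((dot q z)⁻¹ • q) w := by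
    intro w hw hwz
    rw [hdp, ← div_eq_inv_mul, le_div_iff₀ hqz, one_mul]
    exact hge w hw hwz
  have hz1 : dot ((dot q z)⁻¹ • q) z = 1 := by
    rw [hdp]; exact inv_mul_cancel₀ hqz.ne'
  refine ⟨(dot q z)⁻¹ • q, fun i => ?_, hz1, hsup, ⟨hzn, hz1.le⟩, ?_⟩
  · simpa using mul_pos (inv_pos.2 hqz) (hqpos i)
  · rintro y ⟨hy, hy1⟩
    by_contra hc
    have ho : IsOpen {w | R z w}ᶜ := (h.2.1 z).2.isOpen_compl
    have hcont : Continuous (fun s : ℝ => (1 - s) • y) := by fun_prop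
    have hmem : (0:ℝ) ∈ (fun s : ℝ => (1 - s) • y) ⁻¹' {w | R z w}ᶜ := by simpa using hc
    obtain ⟨ε, hε, hb⟩ := Metric.isOpen_iff.1 (ho.preimage hcont) 0 hmem
    set s := min (ε / 2) (1 / 2) with hs
    have hs0 : 0 < s := by positivity
    have hs1 : s ≤ 1 / 2 := min_le_right _ _
    have hsε : s < ε := lt_of_le_of_lt (min_le_left _ _) (by linarith)
    have hsm : s ∈ Metric.ball (0:ℝ) ε := by
      rw [Metric.mem_ball, dist_zero_right, Real.norm_eq_abs, abs_of_pos hs0]; exact hsε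
    have hn : nneg ((1 - s) • y) := fun i => by
      simpa using mul_nonneg (by linarith : (0:ℝ) ≤ 1 - s) (hy i)
    have hnot : ¬ R z ((1 - s) • y) := hb hsm
    have := hsup _ hn ((h.1.1 _ _ hzn hn).resolve_left hnot)
    rw [aux_dot_smul] at this
    nlinarith

theorem aux_telescope {F s : ℝ → ℝ} {C η : ℝ} (hη : 0 < η)
    (hF : ∀ t t', 0 ≤ t → t < t' → t' ≤ 1 → t' - t < η →
      F t' - F t ≤ C * ((s t' - s t) * (t' - t))) : F 1 ≤ F 0 := by
  have key : ∀ n : ℕ, 0 < n → 1 / (n:ℝ) < η → F 1 - F 0 ≤ C * (s 1 - s 0) / n := by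
    intro n hn hnη
    have hn' : (0:ℝ) < n := by exact_mod_cast hn
    have ind : ∀ k : ℕ, k ≤ n → F (k / n) - F 0 ≤ C * (s (k / n) - s 0) / n := by
      intro k
      induction k with
      | zero => intro _; simp
      | succ k ih =>
        intro hk
        have h1 := ih (by omega)
        have hd : ((k + 1 : ℕ) : ℝ) / n - k / n = 1 / n := by
          push_cast; field_simp; ring
        have hpos : 0 < 1 / (n:ℝ) := by positivity
        have h2 := hF (k / n) ((k + 1 : ℕ) / n) (by positivity) (by linarith)
          (by rw [div_le_one hn']; exact_mod_cast hk) (by rw [hd]; exact hnη)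
        rw [hd] at h2
        have : C * (s ((k + 1 : ℕ) / n) - s 0) / n
          = C * ((s ((k + 1 : ℕ) / n) - s (k / n)) * (1 / n)) + C * (s (k / n) - s 0) / n := by
          ring
        linarith
    have := ind n le_rfl
    rwa [div_self hn'.ne'] at this
  have hl : Filter.Tendsto (fun n : ℕ => C * (s 1 - s 0) / (n:ℝ)) Filter.atTop (nhds 0) :=
    tendsto_const_div_atTop_nhds_zero_nat _
  have hl2 : ∀ᶠ n : ℕ in Filter.atTop, 1 / (n:ℝ) < η :=
    (tendsto_const_div_atTop_nhds_zero_nat (1:ℝ)).eventually (gt_mem_nhds hη)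
  have := ge_of_tendsto hl (b := F 1 - F 0) (by
    filter_upwards [hl2, Filter.eventually_gt_atTop 0] with n h1 h2
    exact key n h2 h1)
  linarith

theorem aux_indiff (hL : 0 < L) {R R' : Pref L}
    (h : Regular R) (hLip : Lipschitzian R) (h' : Regular R')
    {f : (Fin L → ℝ) → (Fin L → ℝ)}
    (hdem : ∀ q, posv q → IsDemand R q (f q))
    (hdem' : ∀ q, posv q → IsDemand R' q (f q))
    {x y : Fin L → ℝ} (hx : posv x) (hy : posv y) (hxy : R' x y) (hyx : R' y x) : R y x := by
  have hxn : nneg x := fun i => (hx i).le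
  have hyn : nneg y := fun i => (hy i).le
  obtain ⟨u, hu⟩ := aux_exU h
  have hex : ∀ t : ℝ, ∃ b : ℝ, 0 ≤ t → t ≤ 1 → 0 ≤ b ∧ b ≤ 1 ∧ R' (t • x + b • y) x ∧
      R' x (t • x + b • y) := by
    intro t
    by_cases ht : 0 ≤ t ∧ t ≤ 1
    · have ha : nneg (t • x) := fun i => by simpa using mul_nonneg ht.1 (hxn i)
      have hb : nneg (t • x + y) := fun i => by simpa using add_nonneg (ha i) (hyn i)
      obtain ⟨s, s0, s1, s2, s3⟩ := aux_ivt h' ha hb hxn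
        (h'.1.2 _ _ _ (aux_mono h' hyn (fun i => by simpa using ha i)) hyx)
        (aux_mono h' ha (fun i => by
          simpa using mul_le_of_le_one_left (hxn i) ht.2))
      rw [add_sub_cancel_left] at s2 s3
      exact ⟨s, fun _ _ => ⟨s0, s1, s2, s3⟩⟩
    · exact ⟨0, fun h0 h1 => absurd ⟨h0, h1⟩ ht⟩
  choose ψ hψ using hex
  set z : ℝ → Fin L → ℝ := fun t => t • x + ψ t • y with hzdef
  have hzn : ∀ t, 0 ≤ t → t ≤ 1 → nneg (z t) := by
    intro t h0 h1 i
    have := (hψ t h0 h1).1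
    have := hxn i
    have := hyn i
    simp only [hzdef, Pi.add_apply, Pi.smul_apply, smul_eq_mul]
    positivity
  have hsum : ∀ t, 0 ≤ t → t ≤ 1 → 0 < t + ψ t := by
    intro t h0 h1
    have h2 := (hψ t h0 h1)
    rcases h0.eq_or_lt with e | h0
    · subst e
      rcases h2.1.eq_or_lt with e | h3
      · exfalso
        have h4 := h2.2.2.1
        rw [← e] at h4
        simp only [zero_smul, add_zero] at h4
        refine (h'.2.2.1 x 0 (fun _ => le_rfl) hxn ?_).2 h4
        intro e
        exact absurd (congrFun e ⟨0, hL⟩) (hx _).ne'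
      · linarith
    · linarith [h2.1]
  have hzp : ∀ t, 0 ≤ t → t ≤ 1 → posv (z t) := by
    intro t h0 h1 i
    have h2 := (hψ t h0 h1).1
    have h3 := hsum t h0 h1
    simp only [hzdef, Pi.add_apply, Pi.smul_apply, smul_eq_mul]
    rcases h0.eq_or_lt with e | h0
    · have : 0 < ψ t := by linarith
      have := mul_pos this (hy i)
      have := mul_nonneg h0 (hxn i)
      linarith
    · have := mul_pos h0 (hx i)
      have := mul_nonneg h2 (hyn i)
      linarith
  have hpex : ∀ t : ℝ, ∃ p : Fin L → ℝ, 0 ≤ t → t ≤ 1 → posv p ∧ dot p (z t) = 1 ∧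
      (∀ w, nneg w → R' w (z t) → 1 ≤ dot p w) ∧ IsDemand R p (z t) := by
    intro t
    by_cases ht : 0 ≤ t ∧ t ≤ 1
    · obtain ⟨p, p0, p1, p2, p3⟩ := aux_support hL h' (hzp t ht.1 ht.2)
      refine ⟨p, fun _ _ => ⟨p0, p1, p2, ?_⟩⟩
      rw [aux_demand_unique h' p3 (hdem' p p0)]
      exact hdem p p0
    · exact ⟨0, fun h0 h1 => absurd ⟨h0, h1⟩ ht⟩
  choose p hp using hpex
  have hdz : ∀ q t, dot q (z t) = t * dot q x + ψ t * dot q y := by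
    intro q t
    simp only [hzdef]
    rw [aux_dot_add, aux_dot_smul, aux_dot_smul]
  have hcross : ∀ t t', 0 ≤ t → t ≤ 1 → 0 ≤ t' → t' ≤ 1 → 1 ≤ dot (p t) (z t') := by
    intro t t' h0 h1 h0' h1'
    refine (hp t h0 h1).2.2.1 _ (hzn t' h0' h1') ?_
    exact h'.1.2 _ _ _ (hψ t' h0' h1').2.2.1 (hψ t h0 h1).2.2.2
  set s : ℝ → ℝ := fun t => - (dot (p t) x / dot (p t) y) with hsdef
  have hpx : ∀ t, 0 ≤ t → t ≤ 1 → 0 < dot (p t) x := fun t h0 h1 =>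
    aux_dot_pos hL (hp t h0 h1).1 hx
  have hpy : ∀ t, 0 ≤ t → t ≤ 1 → 0 < dot (p t) y := fun t h0 h1 =>
    aux_dot_pos hL (hp t h0 h1).1 hy
  have hslope : ∀ t t', 0 ≤ t → t ≤ 1 → 0 ≤ t' → t' ≤ 1 →
      0 ≤ ψ t' - ψ t - s t * (t' - t) := by
    intro t t' h0 h1 h0' h1'
    have e1 := hcross t t' h0 h1 h0' h1'
    have e2 := (hp t h0 h1).2.1
    rw [hdz] at e1 e2
    have hy0 := hpy t h0 h1
    have : ψ t' - ψ t - s t * (t' - t) =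
        ((t' * dot (p t) x + ψ t' * dot (p t) y) - (t * dot (p t) x + ψ t * dot (p t) y))
          / dot (p t) y := by
      simp only [hsdef]; field_simp; ring
    rw [this]
    apply div_nonneg _ hy0.le
    linarith
  have hsmono : ∀ t t', 0 ≤ t → t ≤ t' → t' ≤ 1 → s t ≤ s t' := by
    intro t t' h0 hle h1
    rcases hle.eq_or_lt with e | hlt
    · rw [e]
    · have e1 := hslope t t' h0 (by linarith) (by linarith) h1
      have e2 := hslope t' t (by linarith) h1 h0 (by linarith)
      by_contra hc
      push Not at hc
      nlinarith
  -- bounds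
  set c : ℝ := (dot (p 0) x + dot (p 0) y)⁻¹ with hc
  have hx0 := hpx 0 le_rfl zero_le_one
  have hy0 := hpy 0 le_rfl zero_le_one
  have hc0 : 0 < c := by positivity
  have hcz : ∀ t, 0 ≤ t → t ≤ 1 → c ≤ t + ψ t := by
    intro t h0 h1
    have e1 := hcross 0 t le_rfl zero_le_one h0 h1
    rw [hdz] at e1
    rw [hc, inv_le_iff_one_le_mul₀ (by positivity)]
    have := (hψ t h0 h1).1
    nlinarith [mul_nonneg h0 hy0.le, mul_nonneg this hx0.le]
  have : Nonempty (Fin L) := ⟨⟨0, hL⟩⟩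
  obtain ⟨m, hm0, hmx, hmy⟩ : ∃ m : ℝ, 0 < m ∧ (∀ i, m ≤ x i) ∧ (∀ i, m ≤ y i) := by
    obtain ⟨i, hi⟩ := Finite.exists_min x
    obtain ⟨j, hj⟩ := Finite.exists_min y
    exact ⟨min (x i) (y j), lt_min (hx i) (hy j), fun k => (min_le_left _ _).trans (hi k),
      fun k => (min_le_right _ _).trans (hj k)⟩
  have hlow : ∀ t, 0 ≤ t → t ≤ 1 → ∀ i, c * m ≤ z t i := by
    intro t h0 h1 i
    have h2 := hcz t h0 h1
    have h3 := (hψ t h0 h1).1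
    simp only [hzdef, Pi.add_apply, Pi.smul_apply, smul_eq_mul]
    nlinarith [mul_le_mul_of_nonneg_left (hmx i) h0, mul_le_mul_of_nonneg_left (hmy i) h3,
      mul_le_mul_of_nonneg_right h2 hm0.le]
  have hxi : ∀ i, x i ≤ ‖x‖ := fun i => (le_abs_self _).trans (norm_le_pi_norm x i)
  have hyi : ∀ i, y i ≤ ‖y‖ := fun i => (le_abs_self _).trans (norm_le_pi_norm y i)
  have hhigh : ∀ t, 0 ≤ t → t ≤ 1 → ∀ i, z t i ≤ ‖x‖ + ‖y‖ := by
    intro t h0 h1 i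
    have h3 := (hψ t h0 h1)
    simp only [hzdef, Pi.add_apply, Pi.smul_apply, smul_eq_mul]
    have e1 := mul_le_of_le_one_left (hxn i) h1
    have e2 := mul_le_of_le_one_left (hyn i) h3.2.1
    linarith [hxi i, hyi i]
  set b : ℝ := c * m / 2 with hb
  have hb0 : 0 < b := by positivity
  have hny : 0 < ‖y‖ := lt_of_lt_of_le (hy ⟨0, hL⟩) (hyi _)
  set r : ℝ := ‖x‖ + ‖y‖ + b⁻¹ with hr
  have hr0 : 0 < r := by positivity
  have hrb : (1 + r)⁻¹ ≤ b := by
    apply inv_le_of_inv_le₀ hb0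
    have := norm_nonneg x
    linarith
  obtain ⟨K, hK, η, hη, hlip⟩ := aux_u_lip hL h hLip hu hr0
  have hs01 : s 0 ≤ s 1 := hsmono 0 1 le_rfl zero_le_one le_rfl
  set D : ℝ := (s 1 - s 0) * ‖y‖ + 1 with hD
  have hD0 : 0 < D := by
    have := mul_nonneg (sub_nonneg.2 hs01) hny.le
    linarith
  have main : (fun t => u (z t)) 1 ≤ (fun t => u (z t)) 0 := by
    refine aux_telescope (F := fun t => u (z t)) (s := s) (C := K * ‖y‖) (η := min η b / D) (by positivity) ?_
    intro t t' h0 hlt h1 hst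
    have h0' : 0 ≤ t' := by linarith
    have h1' : t ≤ 1 := by linarith
    set δ := ψ t' - ψ t - s t * (t' - t) with hδ
    have hδ0 : 0 ≤ δ := hslope t t' h0 h1' h0' h1
    have hδ1 : δ ≤ (s t' - s t) * (t' - t) := by
      have := hslope t' t h0' h1 h0 h1'
      rw [hδ]; nlinarith
    have hδ2 : δ * ‖y‖ < min η b := by
      have e1 : (s t' - s t) ≤ s 1 - s 0 := by
        linarith [hsmono 0 t le_rfl h0 h1', hsmono t' 1 h0' h1 le_rfl]
      have e2 : δ ≤ (s 1 - s 0) * (t' - t) :=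
        hδ1.trans (mul_le_mul_of_nonneg_right e1 (by linarith))
      have e3 : δ * ‖y‖ ≤ (s 1 - s 0) * (t' - t) * ‖y‖ := mul_le_mul_of_nonneg_right e2 hny.le
      rw [lt_div_iff₀ hD0] at hst
      have : (t' - t) * D = (s 1 - s 0) * (t' - t) * ‖y‖ + (t' - t) := by rw [hD]; ring
      linarith
    obtain ⟨hδη, hδb⟩ := lt_min_iff.1 hδ2
    have hlow' : ∀ i, b ≤ (z t' - δ • y) i := by
      intro i
      have e1 := hlow t' h0' h1 i
      have e2 := mul_le_mul_of_nonneg_left (hyi i) hδ0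
      simp only [Pi.sub_apply, Pi.smul_apply, smul_eq_mul]
      have : c * m = 2 * b := by rw [hb]; ring
      linarith
    have hbox1 : InBox r (z t') := by
      intro i
      have e1 := hlow t' h0' h1 i
      have e2 := hhigh t' h0' h1 i
      have : c * m = 2 * b := by rw [hb]; ring
      have : 0 < b⁻¹ := inv_pos.2 hb0
      constructor <;> linarith
    have hbox2 : InBox r (z t' - δ • y) := by
      intro i
      refine ⟨hrb.trans (hlow' i), ?_⟩
      have e2 := (hbox1 i).2
      have := mul_nonneg hδ0 (hyn i)
      simp only [Pi.sub_apply, Pi.smul_apply, smul_eq_mul]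
      linarith
    have hnorm : ‖z t' - (z t' - δ • y)‖ = δ * ‖y‖ := by
      rw [sub_sub_cancel, norm_smul, Real.norm_eq_abs, abs_of_nonneg hδ0]
    have hL1 := hlip (z t') (z t' - δ • y) hbox1 hbox2 (by rw [hnorm]; exact hδη)
    rw [hnorm] at hL1
    have hn2 : nneg (z t' - δ • y) := fun i => hb0.le.trans (hlow' i)
    have hR : R (z t) (z t' - δ • y) := by
      refine (hp t h0 h1').2.2.2.2 _ ⟨hn2, ?_⟩
      have e2 := (hp t h0 h1').2.1
      have hyt := hpy t h0 h1'
      rw [sub_eq_add_neg, ← neg_smul, aux_dot_add, aux_dot_smul, hdz]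
      rw [hdz] at e2
      rw [← e2, hδ]
      simp only [hsdef]
      apply le_of_eq
      field_simp
      ring
    have hL2 := (aux_u_iff hL h hu (hzn t h0 h1') hn2).1 hR
    have : K * (δ * ‖y‖) ≤ K * ‖y‖ * ((s t' - s t) * (t' - t)) := by
      have := mul_le_mul_of_nonneg_left hδ1 (by positivity : 0 ≤ K * ‖y‖)
      linarith
    show u (z t') - u (z t) ≤ _
    linarith
  have hz1 : R (z 1) x := aux_mono h hxn (fun i => by
    have := mul_nonneg (hψ 1 zero_le_one le_rfl).1 (hyn i)
    simpa [hzdef] using this)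
  have hz0 : R y (z 0) := aux_mono h (hzn 0 le_rfl zero_le_one) (fun i => by
    have := mul_le_of_le_one_left (hyn i) (hψ 0 le_rfl zero_le_one).2.1
    simpa [hzdef] using this)
  have h01 : R (z 0) (z 1) :=
    (aux_u_iff hL h hu (hzn 0 le_rfl zero_le_one) (hzn 1 zero_le_one le_rfl)).2 main
  exact h.1.2 _ _ _ hz0 (h.1.2 _ _ _ h01 hz1)

theorem aux_pos (hL : 0 < L) {R R' : Pref L}
    (h : Regular R) (hLip : Lipschitzian R) (h' : Regular R')
    {f : (Fin L → ℝ) → (Fin L → ℝ)}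
    (hdem : ∀ q, posv q → IsDemand R q (f q))
    (hdem' : ∀ q, posv q → IsDemand R' q (f q))
    {x y : Fin L → ℝ} (hx : posv x) (hy : posv y) (hyx : R' y x) : R y x := by
  have hxn : nneg x := fun i => (hx i).le
  have hyn : nneg y := fun i => (hy i).le
  have h0n : nneg (0 : Fin L → ℝ) := fun i => le_refl _
  obtain ⟨s, s0, s1, h1, h2⟩ := aux_ivt h' h0n hyn hxn hyx (aux_mono h' h0n hxn)
  simp only [sub_zero, zero_add] at h1 h2
  have hs : 0 < s := by
    rcases s0.eq_or_lt with e | h3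
    · exfalso
      rw [← e, zero_smul] at h1
      refine (h'.2.2.1 x 0 h0n hxn ?_).2 h1
      intro e
      exact absurd (congrFun e ⟨0, hL⟩) (hx _).ne'
    · exact h3
  have hsy : posv (s • y) := fun i => by simpa using mul_pos hs (hy i)
  have := aux_indiff hL h hLip h' hdem hdem' hx hsy h2 h1
  exact h.1.2 _ _ _ (aux_mono h (fun i => (hsy i).le) (fun i => by
    simpa using mul_le_of_le_one_left (hyn i) s1)) this

theorem aux_all (hL : 0 < L) {R R' : Pref L}
    (h : Regular R) (hLip : Lipschitzian R) (h' : Regular R')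
    {f : (Fin L → ℝ) → (Fin L → ℝ)}
    (hdem : ∀ q, posv q → IsDemand R q (f q))
    (hdem' : ∀ q, posv q → IsDemand R' q (f q))
    {x y : Fin L → ℝ} (hx : nneg x) (hy : nneg y) (hxy : R' x y) : R x y := by
  have hcont : ∀ v : Fin L → ℝ, Filter.Tendsto (fun e : ℝ => v + fun _ => e)
      (nhdsWithin 0 (Set.Ioi 0)) (nhds v) := by
    intro v
    have : Continuous (fun e : ℝ => v + fun _ => e) := by fun_prop
    have h1 := this.tendsto 0
    have h2 : (v + fun _ => (0:ℝ)) = v := by ext i; simp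
    simp only [h2] at h1
    exact h1.mono_left nhdsWithin_le_nhds
  have step : ∀ e : ℝ, 0 < e → R (x + fun _ => e) y := by
    intro e he
    have hxe : posv (x + fun _ => e) := fun i => by
      have := hx i
      simp only [Pi.add_apply]; linarith
    have hstr : ¬ R' y (x + fun _ => e) := by
      intro hR
      refine (h'.2.2.1 (x + fun _ => e) x hx (fun i => by simp [he.le]) ?_).2
        (h'.1.2 _ _ _ hxy hR)
      intro e'
      have := congrFun e' ⟨0, hL⟩
      simp at this
      linarith
    have ho : IsOpen {w | R' w (x + fun _ => e)}ᶜ := (h'.2.1 _).1.isOpen_compl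
    have hev := (hcont y).eventually (ho.mem_nhds hstr)
    refine (h.2.1 (x + fun _ => e)).2.mem_of_tendsto (hcont y) ?_
    filter_upwards [hev, self_mem_nhdsWithin] with d hd hd0
    have hd0 : 0 < d := hd0
    have hyd : posv (y + fun _ => d) := fun i => by
      have := hy i
      simp only [Pi.add_apply]; linarith
    refine aux_pos hL h hLip h' hdem hdem' hyd hxe ?_
    exact (h'.1.1 _ _ (fun i => (hxe i).le) (fun i => (hyd i).le)).resolve_right hd
  refine (h.2.1 y).1.mem_of_tendsto (hcont x) ?_
  filter_upwards [self_mem_nhdsWithin] with d hd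
  exact step d hd

/-- Mas-Colell's identification theorem: two continuous, monotone,
strictly convex, Lipschitzian preferences generating the same Walrasian demand
function on ℝ^L_{++} coincide on the consumption set. -/
theorem statement18 (hL : 0 < L) (R R' : Pref L)
    (hreg : Regular R) (hLip : Lipschitzian R)
    (hreg' : Regular R') (hLip' : Lipschitzian R')
    (f : (Fin L → ℝ) → (Fin L → ℝ))
    (hdem : ∀ q, posv q → IsDemand R q (f q))
    (hdem' : ∀ q, posv q → IsDemand R' q (f q)) :
    ∀ x y : Fin L → ℝ, nneg x → nneg y → (R x y ↔ R' x y) := by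
  intro x y hx hy
  exact ⟨fun h => aux_all hL hreg' hLip' hreg hdem' hdem hx hy h,
    fun h => aux_all hL hreg hLip hreg' hdem hdem' hx hy h⟩

end Paper
end
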